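/- arXiv:2105.05282 — 8 statements merged into one kernel-verified Lean document; each statement's English description precedes it below -/
import Mathlib

section
/- Let n ≥ 2, 1 < p < n, and q > 0. Let μ, σ be positive Radon measures on ℝⁿ and let C₁, C₂, C₃ > 0 be constants such that: (i) μ(B(x,R)) ≤ C₁·R^{n−p} for all x ∈ ℝⁿ and R > 0; (ii) σ(B(x,R)) · [∫_R^∞ (μ(B(x,r))/r^{n−p})^{1/(p−1)} dr/r]^q ≤ C₂·R^{n−p} for all x ∈ ℝⁿ and R > 0; and (iii) for every ball B = B(x,R), ∫_B (W_p(μ|_{B(x,2R)}))^q dσ ≤ C₃·μ(B(x,2R)). Then there is a constant C depending only on n, p, q, C₁, C₂, C₃ such that ∫_{B(x,R)} (W_p μ)^q dσ ≤ C·R^{n−p} for all x ∈ ℝⁿ and R > 0. -/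
open MeasureTheory Metric Set
open scoped ENNReal NNReal

/-- The Wolff potential `W_p μ(x) = ∫₀^∞ (μ(B(x,ρ))/ρ^{n-p})^{1/(p-1)} dρ/ρ`. -/
noncomputable def wolff (n : ℕ) (p : ℝ) (μ : Measure (EuclideanSpace ℝ (Fin n)))
    (x : EuclideanSpace ℝ (Fin n)) : ℝ≥0∞ :=
  ∫⁻ r in Ioi (0 : ℝ),
    (μ (ball x r) / ENNReal.ofReal (r ^ ((n : ℝ) - p))) ^ (1 / (p - 1)) * ENNReal.ofReal (1 / r)

/-- The integrand of the Wolff potential. -/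
noncomputable def wolffIntegrand (n : ℕ) (p : ℝ) (μ : Measure (EuclideanSpace ℝ (Fin n)))
    (x : EuclideanSpace ℝ (Fin n)) (r : ℝ) : ℝ≥0∞ :=
  (μ (ball x r) / ENNReal.ofReal (r ^ ((n : ℝ) - p))) ^ (1 / (p - 1)) * ENNReal.ofReal (1 / r)

theorem ENNReal.add_rpow_le_two_rpow_mul {q : ℝ} (hq : 0 ≤ q) (a b : ℝ≥0∞) :
    (a + b) ^ q ≤ 2 ^ q * (a ^ q + b ^ q) := by
  have h : a + b ≤ 2 * max a b := by
    rw [two_mul]; exact add_le_add (le_max_left _ _) (le_max_right _ _)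
  calc (a + b) ^ q ≤ (2 * max a b) ^ q := ENNReal.rpow_le_rpow h hq
    _ = 2 ^ q * (max a b) ^ q := ENNReal.mul_rpow_of_nonneg _ _ hq
    _ ≤ 2 ^ q * (a ^ q + b ^ q) := by
      gcongr
      rcases le_total a b with hab | hab
      · rw [max_eq_right hab]; exact le_add_self
      · rw [max_eq_left hab]; exact le_self_add

theorem lintegral_Ioi_comp_two_mul (R : ℝ) (g : ℝ → ℝ≥0∞) :
    ∫⁻ r in Ioi R, ENNReal.ofReal 2 * g (2 * r) = ∫⁻ r in Ioi (2 * R), g r := by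
  have h := lintegral_image_eq_lintegral_abs_deriv_mul (s := Ioi R) (f := fun r : ℝ => 2 * r)
    (f' := fun _ => 2) measurableSet_Ioi
    (fun r _ => by simpa using ((hasDerivAt_id r).const_mul (2 : ℝ)).hasDerivWithinAt)
    (fun a _ b _ hab => by simpa using hab) g
  rw [Set.image_mul_left_Ioi (by norm_num : (0 : ℝ) < 2)] at h
  simpa using h.symm

theorem wolffIntegrand_le_comp_two_mul {n : ℕ} {p : ℝ} (hp : 1 < p)
    (μ : Measure (EuclideanSpace ℝ (Fin n))) {x y : EuclideanSpace ℝ (Fin n)} {R r : ℝ}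
    (hR : 0 < R) (hy : y ∈ ball x R) (hr : R < r) :
    wolffIntegrand n p μ y r ≤ ENNReal.ofReal ((2 ^ ((n : ℝ) - p)) ^ (1 / (p - 1))) *
      (ENNReal.ofReal 2 * wolffIntegrand n p μ x (2 * r)) := by
  have hr0 : 0 < r := hR.trans hr
  have he : 0 ≤ 1 / (p - 1) := by
    have : 0 < p - 1 := by linarith
    positivity
  have hsub : ball y r ⊆ ball x (2 * r) := by
    apply ball_subset_ball'
    rw [mem_ball] at hy
    linarith
  unfold wolffIntegrand
  have h1 : ENNReal.ofReal (1 / r) = ENNReal.ofReal 2 * ENNReal.ofReal (1 / (2 * r)) := by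
    rw [← ENNReal.ofReal_mul (by norm_num)]
    congr 1
    field_simp
  have h2 : μ (ball x (2 * r)) / ENNReal.ofReal (r ^ ((n : ℝ) - p)) =
      ENNReal.ofReal (2 ^ ((n : ℝ) - p)) *
        (μ (ball x (2 * r)) / ENNReal.ofReal ((2 * r) ^ ((n : ℝ) - p))) := by
    have h2pos : (0 : ℝ) < 2 ^ ((n : ℝ) - p) := Real.rpow_pos_of_pos (by norm_num) _
    rw [Real.mul_rpow (by norm_num) hr0.le, ENNReal.ofReal_mul h2pos.le, ← mul_div_assoc,
      ENNReal.mul_div_mul_left _ _ (by simpa using h2pos) ENNReal.ofReal_ne_top]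
  rw [← ENNReal.ofReal_rpow_of_nonneg (by positivity) he]
  calc _ ≤ (μ (ball x (2 * r)) / ENNReal.ofReal (r ^ ((n : ℝ) - p))) ^ (1 / (p - 1)) *
        ENNReal.ofReal (1 / r) := by gcongr
    _ = _ := by
      rw [h2, h1, ENNReal.mul_rpow_of_nonneg _ _ he]
      ring

theorem lintegral_Ioi_wolffIntegrand_le {n : ℕ} {p : ℝ} (hp : 1 < p)
    (μ : Measure (EuclideanSpace ℝ (Fin n))) {x y : EuclideanSpace ℝ (Fin n)} {R : ℝ}
    (hR : 0 < R) (hy : y ∈ ball x R) :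
    ∫⁻ r in Ioi R, wolffIntegrand n p μ y r ≤
      ENNReal.ofReal ((2 ^ ((n : ℝ) - p)) ^ (1 / (p - 1))) *
        ∫⁻ r in Ioi R, wolffIntegrand n p μ x r := by
  calc _ ≤ ∫⁻ r in Ioi R, ENNReal.ofReal ((2 ^ ((n : ℝ) - p)) ^ (1 / (p - 1))) *
        (ENNReal.ofReal 2 * wolffIntegrand n p μ x (2 * r)) :=
        setLIntegral_mono' measurableSet_Ioi
          fun r hr => wolffIntegrand_le_comp_two_mul hp μ hR hy hr
    _ = ENNReal.ofReal ((2 ^ ((n : ℝ) - p)) ^ (1 / (p - 1))) *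
        ∫⁻ r in Ioi (2 * R), wolffIntegrand n p μ x r := by
      rw [lintegral_const_mul' _ _ ENNReal.ofReal_ne_top, lintegral_Ioi_comp_two_mul]
    _ ≤ _ := by
      gcongr
      linarith

theorem lintegral_Ioc_wolffIntegrand_le {n : ℕ} {p : ℝ}
    (μ : Measure (EuclideanSpace ℝ (Fin n))) {x y : EuclideanSpace ℝ (Fin n)} {R : ℝ}
    (hy : y ∈ ball x R) :
    ∫⁻ r in Ioc 0 R, wolffIntegrand n p μ y r ≤ wolff n p (μ.restrict (ball x (2 * R))) y := by
  calc _ ≤ ∫⁻ r in Ioc 0 R, wolffIntegrand n p (μ.restrict (ball x (2 * R))) y r := by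
        refine setLIntegral_mono' measurableSet_Ioc fun r hr => ?_
        have hsub : ball y r ⊆ ball x (2 * R) := by
          apply ball_subset_ball'
          rw [mem_ball] at hy
          linarith [hr.2]
        unfold wolffIntegrand
        rw [Measure.restrict_apply measurableSet_ball, inter_eq_left.2 hsub]
    _ ≤ _ := lintegral_mono_set Ioc_subset_Ioi_self

theorem wolff_le_restrict_add_tail {n : ℕ} {p : ℝ} (hp : 1 < p)
    (μ : Measure (EuclideanSpace ℝ (Fin n))) {x y : EuclideanSpace ℝ (Fin n)} {R : ℝ}
    (hR : 0 < R) (hy : y ∈ ball x R) :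
    wolff n p μ y ≤ wolff n p (μ.restrict (ball x (2 * R))) y +
      ENNReal.ofReal ((2 ^ ((n : ℝ) - p)) ^ (1 / (p - 1))) *
        ∫⁻ r in Ioi R, wolffIntegrand n p μ x r := by
  calc wolff n p μ y = ∫⁻ r in Ioc 0 R ∪ Ioi R, wolffIntegrand n p μ y r := by
        rw [Ioc_union_Ioi_eq_Ioi hR.le]; rfl
    _ ≤ (∫⁻ r in Ioc 0 R, wolffIntegrand n p μ y r) + ∫⁻ r in Ioi R, wolffIntegrand n p μ y r :=
        lintegral_union_le _ _ _
    _ ≤ _ := add_le_add (lintegral_Ioc_wolffIntegrand_le μ hy)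
        (lintegral_Ioi_wolffIntegrand_le hp μ hR hy)

/-- Morrey-type bound `∫_{B(x,R)} (W_p μ)^q dσ ≤ C R^{n-p}` from the local and
tail conditions (i)–(iii). -/
theorem stmt4 (n : ℕ) (hn : 2 ≤ n) (p q : ℝ) (hp : 1 < p) (hpn : p < n) (hq : 0 < q)
    (C₁ C₂ C₃ : ℝ) (hC₁ : 0 < C₁) (hC₂ : 0 < C₂) (hC₃ : 0 < C₃) :
    ∃ C : ℝ, 0 < C ∧
      ∀ μ σ : Measure (EuclideanSpace ℝ (Fin n)),
        IsLocallyFiniteMeasure μ → IsLocallyFiniteMeasure σ →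
        (∀ (x : EuclideanSpace ℝ (Fin n)) (R : ℝ), 0 < R →
          μ (ball x R) ≤ ENNReal.ofReal (C₁ * R ^ ((n : ℝ) - p))) →
        (∀ (x : EuclideanSpace ℝ (Fin n)) (R : ℝ), 0 < R →
          σ (ball x R) *
            (∫⁻ r in Ioi R,
              (μ (ball x r) / ENNReal.ofReal (r ^ ((n : ℝ) - p))) ^ (1 / (p - 1)) *
                ENNReal.ofReal (1 / r)) ^ q ≤
            ENNReal.ofReal (C₂ * R ^ ((n : ℝ) - p))) →
        (∀ (x : EuclideanSpace ℝ (Fin n)) (R : ℝ), 0 < R →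
          ∫⁻ y in ball x R, wolff n p (μ.restrict (ball x (2 * R))) y ^ q ∂σ ≤
            ENNReal.ofReal C₃ * μ (ball x (2 * R))) →
        ∀ (x : EuclideanSpace ℝ (Fin n)) (R : ℝ), 0 < R →
          ∫⁻ y in ball x R, wolff n p μ y ^ q ∂σ ≤
            ENNReal.ofReal (C * R ^ ((n : ℝ) - p)) := by
  set K : ℝ := (2 ^ ((n : ℝ) - p)) ^ (1 / (p - 1)) with hK
  have hK0 : 0 ≤ K := by positivity
  refine ⟨2 ^ q * (C₃ * (C₁ * 2 ^ ((n : ℝ) - p)) + K ^ q * C₂), by positivity, ?_⟩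
  intro μ σ _ _ h1 h2 h3 x R hR
  set T : ℝ≥0∞ := ∫⁻ r in Ioi R, wolffIntegrand n p μ x r with hT
  have h2' : σ (ball x R) * T ^ q ≤ ENNReal.ofReal (C₂ * R ^ ((n : ℝ) - p)) := h2 x R hR
  have hfar : (ENNReal.ofReal K * T) ^ q * σ (ball x R) ≤
      ENNReal.ofReal (K ^ q) * ENNReal.ofReal (C₂ * R ^ ((n : ℝ) - p)) := by
    rw [ENNReal.mul_rpow_of_nonneg _ _ hq.le, ENNReal.ofReal_rpow_of_nonneg hK0 hq.le, mul_assoc,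
      mul_comm (T ^ q)]
    gcongr
  have hnear : ∫⁻ y in ball x R, wolff n p (μ.restrict (ball x (2 * R))) y ^ q ∂σ ≤
      ENNReal.ofReal C₃ * ENNReal.ofReal (C₁ * (2 * R) ^ ((n : ℝ) - p)) :=
    (h3 x R hR).trans (by gcongr; exact h1 x (2 * R) (by positivity))
  calc ∫⁻ y in ball x R, wolff n p μ y ^ q ∂σ
      ≤ ∫⁻ y in ball x R, 2 ^ q * (wolff n p (μ.restrict (ball x (2 * R))) y ^ q +
          (ENNReal.ofReal K * T) ^ q) ∂σ :=
        setLIntegral_mono' measurableSet_ball fun y hy =>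
          (ENNReal.rpow_le_rpow (wolff_le_restrict_add_tail hp μ hR hy) hq.le).trans
            (ENNReal.add_rpow_le_two_rpow_mul hq.le _ _)
    _ = 2 ^ q * ((∫⁻ y in ball x R, wolff n p (μ.restrict (ball x (2 * R))) y ^ q ∂σ) +
          (ENNReal.ofReal K * T) ^ q * σ (ball x R)) := by
        rw [lintegral_const_mul' _ _ (ENNReal.rpow_ne_top_of_nonneg hq.le (by norm_num)),
          lintegral_add_right _ measurable_const, setLIntegral_const]
    _ ≤ 2 ^ q * (ENNReal.ofReal C₃ * ENNReal.ofReal (C₁ * (2 * R) ^ ((n : ℝ) - p)) +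
          ENNReal.ofReal (K ^ q) * ENNReal.ofReal (C₂ * R ^ ((n : ℝ) - p))) := by
        gcongr
    _ = _ := by
        have h2q : (2 : ℝ≥0∞) ^ q = ENNReal.ofReal (2 ^ q) := by
          rw [← ENNReal.ofReal_rpow_of_nonneg (by norm_num) hq.le]; norm_num
        rw [h2q, ← ENNReal.ofReal_mul hC₃.le, ← ENNReal.ofReal_mul (by positivity),
          ← ENNReal.ofReal_add (by positivity) (by positivity),
          ← ENNReal.ofReal_mul (by positivity), Real.mul_rpow (by norm_num) hR.le]
        congr 1
        ring
end

section
/- Let n ≥ 2, 1 < p < n, and θ > 0. Let μ be a positive Radon measure on ℝⁿ with μ(B(x,r)) ≤ M·r^{n−p} for all x ∈ ℝⁿ and r > 0. Then there is a constant C depending only on n, p, θ, and M such that for all x ∈ ℝⁿ and R > 0, ∫_{B(x,R)} [ ∫₀^{6R} (μ(B(y,t))/t^{n−p})^{1/(p−1)} dt/t ]^θ dy ≤ C·Rⁿ. -/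
open MeasureTheory Metric Set
open scoped ENNReal NNReal

theorem lintegral_Ioo_rpow {c b : ℝ} (hc : -1 < c) (hb : 0 < b) :
    ∫⁻ t in Ioo (0 : ℝ) b, ENNReal.ofReal (t ^ c) = ENNReal.ofReal (b ^ (c + 1) / (c + 1)) := by
  have hi : IntegrableOn (fun t : ℝ => t ^ c) (Ioo 0 b) :=
    ((intervalIntegrable_iff_integrableOn_Ioo_of_le hb.le).1
      (intervalIntegral.intervalIntegrable_rpow' hc))
  rw [← ofReal_integral_eq_lintegral_ofReal hi, ← integral_Ioc_eq_integral_Ioo,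
    ← intervalIntegral.integral_of_le hb.le, integral_rpow (Or.inl hc),
    Real.zero_rpow (by linarith), sub_zero]
  filter_upwards [ae_restrict_mem measurableSet_Ioo] with t ht
  exact Real.rpow_nonneg ht.1.le _

theorem lintegral_div_rpow_le {g : ℝ → ℝ≥0∞} (hg : Measurable g) {s b : ℝ} (hs : 1 < s)
    (hb : 0 < b) :
    (∫⁻ t in Ioo (0 : ℝ) b, g t * ENNReal.ofReal (1 / t)) ^ s ≤
      ENNReal.ofReal ((s - 1) ^ (s - 1) * b) *
        ∫⁻ t in Ioo (0 : ℝ) b, g t ^ s * ENNReal.ofReal (t ^ (-2 : ℝ)) := by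
  have hs0 : 0 < s := by linarith
  have hs1 : 0 < s - 1 := by linarith
  have hpq : s.HolderConjugate (s / (s - 1)) := Real.HolderConjugate.conjExponent hs
  have h1 : ∫⁻ t in Ioo (0 : ℝ) b, g t * ENNReal.ofReal (1 / t) =
      ∫⁻ t in Ioo (0 : ℝ) b, ((fun t => g t * ENNReal.ofReal (t ^ (-2 / s))) *
        fun t => ENNReal.ofReal (t ^ (2 / s - 1))) t := by
    refine setLIntegral_congr_fun measurableSet_Ioo fun t ht => ?_
    simp only [Pi.mul_apply]
    rw [mul_assoc, ← ENNReal.ofReal_mul (Real.rpow_nonneg ht.1.le _), ← Real.rpow_add ht.1]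
    rw [show -2 / s + (2 / s - 1) = -1 by ring, Real.rpow_neg_one, one_div]
  have h2 : ∫⁻ t in Ioo (0 : ℝ) b, (g t * ENNReal.ofReal (t ^ (-2 / s))) ^ s =
      ∫⁻ t in Ioo (0 : ℝ) b, g t ^ s * ENNReal.ofReal (t ^ (-2 : ℝ)) := by
    refine setLIntegral_congr_fun measurableSet_Ioo fun t ht => ?_
    rw [ENNReal.mul_rpow_of_nonneg _ _ hs0.le,
      ENNReal.ofReal_rpow_of_nonneg (Real.rpow_nonneg ht.1.le _) hs0.le,
      ← Real.rpow_mul ht.1.le, div_mul_cancel₀ _ hs0.ne']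
  have h3 : ∫⁻ t in Ioo (0 : ℝ) b, ENNReal.ofReal (t ^ (2 / s - 1)) ^ (s / (s - 1)) =
      ENNReal.ofReal (b ^ (1 / (s - 1)) * (s - 1)) := by
    have he : (2 / s - 1) * (s / (s - 1)) + 1 = 1 / (s - 1) := by
      field_simp
      ring
    have : 0 < 1 / (s - 1) := by positivity
    rw [show b ^ (1 / (s - 1)) * (s - 1) = b ^ (1 / (s - 1)) / (1 / (s - 1)) by simp, ← he,
      ← lintegral_Ioo_rpow (by linarith) hb]
    refine setLIntegral_congr_fun measurableSet_Ioo fun t ht => ?_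
    rw [ENNReal.ofReal_rpow_of_nonneg (Real.rpow_nonneg ht.1.le _) (by positivity),
      ← Real.rpow_mul ht.1.le]
  have h4 := ENNReal.lintegral_mul_le_Lp_mul_Lq (volume.restrict (Ioo (0 : ℝ) b)) hpq
    (f := fun t => g t * ENNReal.ofReal (t ^ (-2 / s)))
    (g := fun t => ENNReal.ofReal (t ^ (2 / s - 1))) (by fun_prop) (by fun_prop)
  rw [← h1, h2, h3] at h4
  refine (ENNReal.rpow_le_rpow h4 hs0.le).trans_eq ?_
  rw [ENNReal.mul_rpow_of_nonneg _ _ hs0.le, ← ENNReal.rpow_mul, ← ENNReal.rpow_mul,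
    one_div_mul_cancel hs0.ne', ENNReal.rpow_one, mul_comm]
  congr 1
  have he : 1 / (s / (s - 1)) * s = s - 1 := by field_simp
  rw [he, ENNReal.ofReal_rpow_of_nonneg (by positivity) hs1.le,
    Real.mul_rpow (by positivity) hs1.le, ← Real.rpow_mul hb.le, one_div_mul_cancel hs1.ne',
    Real.rpow_one, mul_comm]

theorem measurable_measure_ball {E : Type*} [NormedAddCommGroup E] [MeasurableSpace E]
    [BorelSpace E] [SecondCountableTopology E] (μ : Measure E) [SFinite μ] :
    Measurable fun q : E × ℝ => μ (ball q.1 q.2) := by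
  have h : MeasurableSet {w : (E × ℝ) × E | dist w.2 w.1.1 < w.1.2} :=
    measurableSet_lt (by fun_prop) (by fun_prop)
  exact measurable_measure_prodMk_left h

theorem setLIntegral_measure_ball_le {E : Type*} [NormedAddCommGroup E] [MeasurableSpace E]
    [BorelSpace E] [SecondCountableTopology E] (μ ν : Measure E) [SFinite μ] [SFinite ν]
    [ν.IsAddLeftInvariant] (x : E) (R t : ℝ) :
    ∫⁻ y in ball x R, μ (ball y t) ∂ν ≤ ν (ball 0 t) * μ (ball x (R + t)) := by
  have h : MeasurableSet {w : E × E | dist w.1 w.2 < t} :=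
    measurableSet_lt (by fun_prop) (by fun_prop)
  have hb (z : E) : ν (ball z t) = ν (ball 0 t) := by
    have := measure_preimage_add ν (-z) (ball 0 t)
    rwa [preimage_add_ball, sub_neg_eq_add, zero_add] at this
  calc ∫⁻ y in ball x R, μ (ball y t) ∂ν
      = ∫⁻ y in ball x R, ∫⁻ z, {w : E × E | dist w.1 w.2 < t}.indicator 1 (y, z) ∂μ ∂ν := by
        refine lintegral_congr fun y => ?_
        rw [← lintegral_indicator_one measurableSet_ball]
        refine lintegral_congr fun z => ?_
        simp [indicator, dist_comm]
    _ = ∫⁻ z, ∫⁻ y in ball x R, {w : E × E | dist w.1 w.2 < t}.indicator 1 (y, z) ∂ν ∂μ :=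
        lintegral_lintegral_swap ((measurable_one.indicator h).aemeasurable)
    _ ≤ ∫⁻ z, (ball x (R + t)).indicator (fun _ => ν (ball 0 t)) z ∂μ := by
        refine lintegral_mono fun z => ?_
        by_cases hz : z ∈ ball x (R + t)
        · rw [indicator_of_mem hz, ← hb z, ← lintegral_indicator_one measurableSet_ball]
          refine (setLIntegral_le_lintegral _ _).trans (lintegral_mono fun y => ?_)
          simp [indicator]
        · rw [indicator_of_notMem hz, setLIntegral_congr_fun measurableSet_ball (g := 0)]
          · simp
          · intro y hy
            simp only [indicator, mem_ofPred_eq, Pi.zero_apply]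
            rw [if_neg]
            intro hyz
            rw [mem_ball] at hy hz
            rw [dist_comm] at hyz
            linarith [dist_triangle z y x]
    _ = ν (ball 0 t) * μ (ball x (R + t)) := lintegral_indicator_const measurableSet_ball _

theorem setLIntegral_measure_ball_div_rpow_le {n : ℕ} (hn : n ≠ 0) {p A : ℝ}
    (hA : 0 ≤ A) (μ : Measure (EuclideanSpace ℝ (Fin n))) [SFinite μ]
    (hμ : ∀ (x : EuclideanSpace ℝ (Fin n)) (r : ℝ), 0 < r →
      μ (ball x r) ≤ ENNReal.ofReal (A * r ^ ((n : ℝ) - p)))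
    (x : EuclideanSpace ℝ (Fin n)) {R t : ℝ} (hR : 0 < R) (ht : t ∈ Ioo 0 (6 * R)) :
    ∫⁻ y in ball x R, μ (ball y t) / ENNReal.ofReal (t ^ ((n : ℝ) - p)) ≤
      ENNReal.ofReal ((volume (ball (0 : EuclideanSpace ℝ (Fin n)) 1)).toReal *
        (A * (7 * R) ^ ((n : ℝ) - p)) * t ^ p) := by
  have : Nonempty (Fin n) := Fin.pos_iff_nonempty.1 (Nat.pos_of_ne_zero hn)
  have ht0 : 0 < t := ht.1
  have hpos : 0 < t ^ ((n : ℝ) - p) := Real.rpow_pos_of_pos ht0 _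
  have hvol : volume (ball (0 : EuclideanSpace ℝ (Fin n)) t) =
      ENNReal.ofReal (t ^ n * (volume (ball (0 : EuclideanSpace ℝ (Fin n)) 1)).toReal) := by
    rw [Measure.addHaar_ball _ _ ht0.le, finrank_euclideanSpace_fin,
      ENNReal.ofReal_mul (by positivity), ENNReal.ofReal_toReal measure_ball_lt_top.ne]
  have hmono : μ (ball x (R + t)) ≤ ENNReal.ofReal (A * (7 * R) ^ ((n : ℝ) - p)) :=
    (measure_mono (ball_subset_ball (by linarith [ht.2]))).trans (hμ x (7 * R) (by positivity))
  simp only [div_eq_mul_inv]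
  rw [lintegral_mul_const' _ _ (by simpa using hpos), ← div_eq_mul_inv]
  refine ENNReal.div_le_of_le_mul ((setLIntegral_measure_ball_le μ volume x R t).trans ?_)
  rw [hvol]
  refine (mul_le_mul_right hmono _).trans_eq ?_
  rw [← ENNReal.ofReal_mul (by positivity), ← ENNReal.ofReal_mul (by positivity)]
  congr 1
  have : t ^ n = t ^ p * t ^ ((n : ℝ) - p) := by
    rw [← Real.rpow_add ht0, add_sub_cancel, Real.rpow_natCast]
  rw [this]
  ring

theorem ENNReal.rpow_le_rpow_sub_one_mul_self {a A : ℝ≥0∞} (h : a ≤ A) (hA : A ≠ ∞)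
    {r : ℝ} (hr : 1 ≤ r) :
    a ^ r ≤ A ^ (r - 1) * a := by
  rcases eq_or_ne a 0 with rfl | ha
  · simp [ENNReal.zero_rpow_of_pos (by linarith : 0 < r)]
  · calc a ^ r = a ^ (r - 1) * a := by
          conv_rhs => rw [← ENNReal.rpow_one a]
          rw [← ENNReal.rpow_mul, one_mul, ← ENNReal.rpow_add _ _ ha (ne_top_of_le_ne_top hA h),
            sub_add_cancel]
      _ ≤ A ^ (r - 1) * a := by
          gcongr

theorem ENNReal.rpow_le_one_add_rpow (a : ℝ≥0∞) {θ s : ℝ} (hθ : 0 ≤ θ) (hs : θ ≤ s) :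
    a ^ θ ≤ 1 + a ^ s := by
  rcases le_total a 1 with h | h
  · exact (ENNReal.rpow_le_one h hθ).trans le_self_add
  · exact (ENNReal.rpow_le_rpow_of_exponent_le h hs).trans le_add_self

theorem setLIntegral_wolff_rpow_le {n : ℕ} (hn : n ≠ 0) {p A s : ℝ} (hp : 1 < p)
    (hA : 0 < A) (hs : 1 < s) (hps : p - 1 ≤ s)
    (μ : Measure (EuclideanSpace ℝ (Fin n))) [SFinite μ]
    (hμ : ∀ (x : EuclideanSpace ℝ (Fin n)) (r : ℝ), 0 < r →
      μ (ball x r) ≤ ENNReal.ofReal (A * r ^ ((n : ℝ) - p)))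
    (x : EuclideanSpace ℝ (Fin n)) {R : ℝ} (hR : 0 < R) :
    ∫⁻ y in ball x R, (∫⁻ t in Ioo (0 : ℝ) (6 * R),
        (μ (ball y t) / ENNReal.ofReal (t ^ ((n : ℝ) - p))) ^ (1 / (p - 1)) *
          ENNReal.ofReal (1 / t)) ^ s ≤
      ENNReal.ofReal ((s - 1) ^ (s - 1) * A ^ (s / (p - 1)) *
        (volume (ball (0 : EuclideanSpace ℝ (Fin n)) 1)).toReal *
        (6 ^ p * 7 ^ ((n : ℝ) - p) / (p - 1)) * R ^ (n : ℝ)) := by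
  have hp1 : 0 < p - 1 := by linarith
  have hs1 : 0 < s - 1 := by linarith
  obtain ⟨κ, hκdef⟩ : ∃ κ, κ = (volume (ball (0 : EuclideanSpace ℝ (Fin n)) 1)).toReal :=
    ⟨_, rfl⟩
  have hκ : 0 ≤ κ := hκdef ▸ ENNReal.toReal_nonneg
  rw [← hκdef]
  have h6R : 0 < 6 * R := by positivity
  have hmeas : Measurable fun q : EuclideanSpace ℝ (Fin n) × ℝ =>
      (μ (ball q.1 q.2) / ENNReal.ofReal (q.2 ^ ((n : ℝ) - p))) ^ (1 / (p - 1)) :=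
    ((measurable_measure_ball μ).div (by fun_prop)).pow_const _
  have hr : 1 ≤ s / (p - 1) := (one_le_div hp1).2 hps
  have hinner : ∀ t ∈ Ioo (0 : ℝ) (6 * R), ∫⁻ y in ball x R,
      ((μ (ball y t) / ENNReal.ofReal (t ^ ((n : ℝ) - p))) ^ (1 / (p - 1))) ^ s *
        ENNReal.ofReal (t ^ (-2 : ℝ)) ≤
      ENNReal.ofReal (A ^ (s / (p - 1)) * κ * (7 * R) ^ ((n : ℝ) - p)) *
        ENNReal.ofReal (t ^ (p - 2)) := by
    intro t ht
    have ht0 : 0 < t := ht.1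
    rw [lintegral_mul_const' _ _ ENNReal.ofReal_ne_top]
    have hle : ∀ y, ((μ (ball y t) / ENNReal.ofReal (t ^ ((n : ℝ) - p))) ^ (1 / (p - 1))) ^ s ≤
        ENNReal.ofReal A ^ (s / (p - 1) - 1) *
          (μ (ball y t) / ENNReal.ofReal (t ^ ((n : ℝ) - p))) := by
      intro y
      rw [← ENNReal.rpow_mul, one_div_mul_eq_div]
      refine ENNReal.rpow_le_rpow_sub_one_mul_self (ENNReal.div_le_of_le_mul ?_)
        ENNReal.ofReal_ne_top hr
      rw [← ENNReal.ofReal_mul hA.le]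
      exact hμ y t ht0
    refine (mul_le_mul_left ((lintegral_mono hle).trans_eq
      (lintegral_const_mul' _ _ (by
        rw [ENNReal.ofReal_rpow_of_pos hA]; exact ENNReal.ofReal_ne_top))) _).trans ?_
    refine (mul_le_mul_left (mul_le_mul_right
      (setLIntegral_measure_ball_div_rpow_le hn hA.le μ hμ x hR ht) _) _).trans_eq ?_
    rw [← hκdef, ENNReal.ofReal_rpow_of_pos hA, ← ENNReal.ofReal_mul (by positivity),
      ← ENNReal.ofReal_mul (by positivity), ← ENNReal.ofReal_mul (by positivity)]
    congr 1
    rw [Real.rpow_sub_one hA.ne', sub_eq_add_neg p 2, Real.rpow_add ht0]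
    field_simp
  calc _ ≤ ∫⁻ y in ball x R, ENNReal.ofReal ((s - 1) ^ (s - 1) * (6 * R)) *
        ∫⁻ t in Ioo (0 : ℝ) (6 * R),
          ((μ (ball y t) / ENNReal.ofReal (t ^ ((n : ℝ) - p))) ^ (1 / (p - 1))) ^ s *
            ENNReal.ofReal (t ^ (-2 : ℝ)) := by
        exact lintegral_mono fun y =>
          lintegral_div_rpow_le (hmeas.comp measurable_prodMk_left) hs h6R
    _ = ENNReal.ofReal ((s - 1) ^ (s - 1) * (6 * R)) * ∫⁻ t in Ioo (0 : ℝ) (6 * R),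
          ∫⁻ y in ball x R,
            ((μ (ball y t) / ENNReal.ofReal (t ^ ((n : ℝ) - p))) ^ (1 / (p - 1))) ^ s *
              ENNReal.ofReal (t ^ (-2 : ℝ)) := by
        rw [lintegral_const_mul' _ _ ENNReal.ofReal_ne_top, lintegral_lintegral_swap]
        exact ((hmeas.pow_const s).mul (by fun_prop)).aemeasurable
    _ ≤ ENNReal.ofReal ((s - 1) ^ (s - 1) * (6 * R)) * ∫⁻ t in Ioo (0 : ℝ) (6 * R),
          ENNReal.ofReal (A ^ (s / (p - 1)) * κ * (7 * R) ^ ((n : ℝ) - p)) *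
            ENNReal.ofReal (t ^ (p - 2)) :=
        mul_le_mul_right (setLIntegral_mono' measurableSet_Ioo hinner) _
    _ = _ := by
        rw [lintegral_const_mul' _ _ ENNReal.ofReal_ne_top,
          lintegral_Ioo_rpow (by linarith) (by positivity), show p - 2 + 1 = p - 1 by ring,
          ← ENNReal.ofReal_mul (by positivity), ← ENNReal.ofReal_mul (by positivity)]
        congr 1
        rw [Real.mul_rpow (by norm_num) hR.le, Real.mul_rpow (by norm_num) hR.le,
          Real.rpow_sub_one (by norm_num) p, Real.rpow_sub_one hR.ne' p, Real.rpow_sub hR]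
        have := Real.rpow_pos_of_pos hR p
        field_simp

/-- Under the growth condition `μ(B(x,r)) ≤ M r^{n-p}`, the truncated Wolff integral raised
to any power `θ > 0` integrates over `B(x,R)` to at most `C Rⁿ`. -/
theorem stmt6 (n : ℕ) (hn : 2 ≤ n) (p θ : ℝ) (hp : 1 < p) (hpn : p < n) (hθ : 0 < θ)
    (M : ℝ) :
    ∃ C : ℝ, 0 < C ∧
      ∀ μ : Measure (EuclideanSpace ℝ (Fin n)), IsLocallyFiniteMeasure μ →
        (∀ (x : EuclideanSpace ℝ (Fin n)) (r : ℝ), 0 < r →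
          μ (ball x r) ≤ ENNReal.ofReal (M * r ^ ((n : ℝ) - p))) →
        ∀ (x : EuclideanSpace ℝ (Fin n)) (R : ℝ), 0 < R →
          (∫⁻ y in ball x R,
            (∫⁻ t in Ioo (0 : ℝ) (6 * R),
              (μ (ball y t) / ENNReal.ofReal (t ^ ((n : ℝ) - p))) ^ (1 / (p - 1)) *
                ENNReal.ofReal (1 / t)) ^ θ) ≤
            ENNReal.ofReal (C * R ^ (n : ℝ)) := by
  have hn0 : n ≠ 0 := by omega
  have : Nonempty (Fin n) := Fin.pos_iff_nonempty.1 (Nat.pos_of_ne_zero hn0)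
  set κ := (volume (ball (0 : EuclideanSpace ℝ (Fin n)) 1)).toReal with hκdef
  have hκ : 0 < κ :=
    ENNReal.toReal_pos (measure_ball_pos _ _ one_pos).ne' measure_ball_lt_top.ne
  set A := max M 1
  have hA : 0 < A := lt_max_of_lt_right one_pos
  set s := max θ (max 2 (p - 1))
  have hs : 1 < s := lt_max_of_lt_right (lt_max_of_lt_left one_lt_two)
  have hps : p - 1 ≤ s := (le_max_right _ _).trans (le_max_right _ _)
  have hp1 : 0 < p - 1 := by linarith
  have hs1 : 0 < s - 1 := by linarith
  set D := (s - 1) ^ (s - 1) * A ^ (s / (p - 1)) * κ * (6 ^ p * 7 ^ ((n : ℝ) - p) / (p - 1))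
    with hD
  have hD0 : 0 < D := by positivity
  refine ⟨κ + D, by positivity, fun μ hloc hμ x R hR => ?_⟩
  have hμA : ∀ (x : EuclideanSpace ℝ (Fin n)) (r : ℝ), 0 < r →
      μ (ball x r) ≤ ENNReal.ofReal (A * r ^ ((n : ℝ) - p)) := fun x r hr =>
    (hμ x r hr).trans (ENNReal.ofReal_le_ofReal
      (mul_le_mul_of_nonneg_right (le_max_left _ _) (by positivity)))
  refine (lintegral_mono fun y =>
    ENNReal.rpow_le_one_add_rpow _ hθ.le (le_max_left θ (max 2 (p - 1)))).trans ?_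
  rw [lintegral_add_left measurable_const, setLIntegral_one, add_mul,
    ENNReal.ofReal_add (by positivity) (by positivity)]
  refine add_le_add (le_of_eq ?_)
    (setLIntegral_wolff_rpow_le hn0 hp hA hs hps μ hμA x hR)
  rw [Measure.addHaar_ball _ _ hR.le, finrank_euclideanSpace_fin, ENNReal.ofReal_mul hκ.le, hκdef,
    ENNReal.ofReal_toReal measure_ball_lt_top.ne, mul_comm, Real.rpow_natCast]
end

section
/- Let n ≥ 2 and 2 < p < n. There is a constant C depending only on p and n such that for every positive Radon measure σ on ℝⁿ and every x ∈ ℝⁿ, I_p σ(x) ≤ C·(W_p σ(x))^{p−1}. -/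
open MeasureTheory Metric Set
open scoped ENNReal NNReal

/-- The Riesz potential `I_α σ(x) = ∫ |x-y|^{α-n} dσ(y)` (valued in `[0,∞]`). -/
noncomputable def riesz (n : ℕ) (α : ℝ) (σ : Measure (EuclideanSpace ℝ (Fin n)))
    (x : EuclideanSpace ℝ (Fin n)) : ℝ≥0∞ :=
  ∫⁻ y, ENNReal.ofReal ‖x - y‖ ^ (α - (n : ℝ)) ∂σ

/-- A negative power of the distance is dominated by the integral of the corresponding density
over the radii exceeding that distance. -/
lemma ofReal_rpow_le_lintegral_Ioi {a d : ℝ} (ha : a < 0) (hd : 0 ≤ d) :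
    ENNReal.ofReal d ^ a ≤
      ENNReal.ofReal (-a) * ∫⁻ r in Ioi d, ENNReal.ofReal (r ^ (a - 1)) := by
  have ha' : ENNReal.ofReal (-a) ≠ 0 := by simpa using ha
  rcases hd.eq_or_lt with rfl | hd
  · have htop : ∫⁻ r in Ioi (0 : ℝ), ENNReal.ofReal (r ^ (a - 1)) = ∞ := by
      by_contra hne
      refine not_integrableOn_Ioi_rpow (a - 1) ⟨by fun_prop, ?_⟩
      rw [hasFiniteIntegral_iff_ofReal]
      · exact lt_top_iff_ne_top.2 hne
      · filter_upwards [ae_restrict_mem measurableSet_Ioi] with r hr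
        exact Real.rpow_nonneg (le_of_lt hr) _
    rw [htop, ENNReal.mul_top ha']
    exact le_top
  · have hnn : 0 ≤ᵐ[volume.restrict (Ioi d)] fun r : ℝ => r ^ (a - 1) := by
      filter_upwards [ae_restrict_mem measurableSet_Ioi] with r hr
      exact Real.rpow_nonneg (hd.trans hr).le _
    rw [← ofReal_integral_eq_lintegral_ofReal (integrableOn_Ioi_rpow_of_lt (by linarith) hd) hnn,
      integral_Ioi_rpow_of_lt (by linarith) hd, ← ENNReal.ofReal_mul (by linarith),
      ENNReal.ofReal_rpow_of_pos hd]
    refine le_of_eq ?_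
    congr 1
    have : a ≠ 0 := ha.ne
    rw [sub_add_cancel]
    field_simp

/-- Fubini bound of a Riesz potential by the integral of the masses of concentric balls. -/
lemma riesz_le_lintegral_ball {n : ℕ} {p : ℝ} (hpn : p < n)
    (σ : Measure (EuclideanSpace ℝ (Fin n))) [SFinite σ] (x : EuclideanSpace ℝ (Fin n)) :
    riesz n p σ x ≤ ENNReal.ofReal (n - p) *
      ∫⁻ r in Ioi (0 : ℝ), σ (ball x r) * ENNReal.ofReal (r ^ (p - n - 1)) := by
  have hmeas : Measurable (fun z : EuclideanSpace ℝ (Fin n) × ℝ =>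
      {w : EuclideanSpace ℝ (Fin n) × ℝ | ‖x - w.1‖ < w.2}.indicator
        (fun w => ENNReal.ofReal (w.2 ^ (p - n - 1))) z) := by
    refine Measurable.indicator (by fun_prop) ?_
    exact measurableSet_lt (by fun_prop) (by fun_prop)
  calc riesz n p σ x
      ≤ ∫⁻ y, (ENNReal.ofReal (n - p) *
          ∫⁻ r in Ioi (0 : ℝ), {w : EuclideanSpace ℝ (Fin n) × ℝ | ‖x - w.1‖ < w.2}.indicator
            (fun w => ENNReal.ofReal (w.2 ^ (p - n - 1))) (y, r)) ∂σ := by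
        refine lintegral_mono fun y => ?_
        refine (ofReal_rpow_le_lintegral_Ioi (by linarith) (norm_nonneg (x - y))).trans ?_
        rw [neg_sub, ← lintegral_indicator measurableSet_Ioi, ← lintegral_indicator measurableSet_Ioi]
        gcongr with r
        by_cases hr : ‖x - y‖ < r
        · simp [hr, (norm_nonneg (x - y)).trans_lt hr]
        · simp [hr]
    _ = ENNReal.ofReal (n - p) *
          ∫⁻ r in Ioi (0 : ℝ), ∫⁻ y, {w : EuclideanSpace ℝ (Fin n) × ℝ | ‖x - w.1‖ < w.2}.indicator
            (fun w => ENNReal.ofReal (w.2 ^ (p - n - 1))) (y, r) ∂σ := by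
        rw [lintegral_const_mul' _ _ ENNReal.ofReal_ne_top, lintegral_lintegral_swap]
        exact hmeas.aemeasurable
    _ = _ := by
        congr 1
        refine lintegral_congr fun r => ?_
        have : ∀ y, {w : EuclideanSpace ℝ (Fin n) × ℝ | ‖x - w.1‖ < w.2}.indicator
            (fun w => ENNReal.ofReal (w.2 ^ (p - n - 1))) (y, r) =
            (ball x r).indicator (fun _ => ENNReal.ofReal (r ^ (p - n - 1))) y := fun y => by
          simp [indicator, dist_comm y x, dist_eq_norm]
        simp_rw [this]
        rw [lintegral_indicator_const measurableSet_ball, mul_comm]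

/-- The integrand of the Wolff potential, at a fixed radius, is bounded by the potential. -/
lemma rpow_ball_le_wolff {n : ℕ} {p : ℝ} (hp : 1 < p) (hpn : p < n)
    (σ : Measure (EuclideanSpace ℝ (Fin n))) (x : EuclideanSpace ℝ (Fin n)) {r : ℝ} (hr : 0 < r) :
    (σ (ball x r) / ENNReal.ofReal (r ^ ((n : ℝ) - p))) ^ (1 / (p - 1)) ≤
      (ENNReal.ofReal (2 ^ ((n : ℝ) - p)) ^ (1 / (p - 1)) * 2) * wolff n p σ x := by
  set e := 1 / (p - 1)
  have he : 0 ≤ e := one_div_nonneg.2 (by linarith)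
  set K := ENNReal.ofReal (2 ^ ((n : ℝ) - p))
  have hK0 : K ≠ 0 := by simp only [K, ne_eq, ENNReal.ofReal_eq_zero, not_le]; positivity
  have hKt : K ≠ ∞ := ENNReal.ofReal_ne_top
  set h := (σ (ball x r) / ENNReal.ofReal (r ^ ((n : ℝ) - p))) ^ e
  have hlow : (K ^ e)⁻¹ * h * 2⁻¹ ≤ wolff n p σ x := by
    calc (K ^ e)⁻¹ * h * 2⁻¹
        = ∫⁻ _ in Ioc r (2 * r), (K ^ e)⁻¹ * h * ENNReal.ofReal (1 / (2 * r)) := by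
          rw [setLIntegral_const, Real.volume_Ioc, mul_assoc _ (ENNReal.ofReal _),
            ← ENNReal.ofReal_mul (by positivity)]
          have : 1 / (2 * r) * (2 * r - r) = 2⁻¹ := by field_simp; ring
          rw [this, ENNReal.ofReal_inv_of_pos two_pos, ENNReal.ofReal_ofNat]
      _ ≤ ∫⁻ s in Ioc r (2 * r),
          (σ (ball x s) / ENNReal.ofReal (s ^ ((n : ℝ) - p))) ^ e * ENNReal.ofReal (1 / s) := by
          refine setLIntegral_mono' measurableSet_Ioc fun s hs => ?_
          have hs0 : 0 < s := hr.trans hs.1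
          have hpow : s ^ ((n : ℝ) - p) ≤ 2 ^ ((n : ℝ) - p) * r ^ ((n : ℝ) - p) := by
            rw [← Real.mul_rpow two_pos.le hr.le]
            exact Real.rpow_le_rpow hs0.le hs.2 (by linarith)
          refine mul_le_mul' ?_ (ENNReal.ofReal_le_ofReal (one_div_le_one_div_of_le hs0 hs.2))
          rw [← ENNReal.inv_rpow, ← ENNReal.mul_rpow_of_nonneg _ _ he]
          refine ENNReal.rpow_le_rpow ?_ he
          calc K⁻¹ * (σ (ball x r) / ENNReal.ofReal (r ^ ((n : ℝ) - p)))
              = σ (ball x r) / ENNReal.ofReal (2 ^ ((n : ℝ) - p) * r ^ ((n : ℝ) - p)) := by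
                rw [ENNReal.ofReal_mul (by positivity), div_eq_mul_inv, div_eq_mul_inv,
                  ENNReal.mul_inv (Or.inl hK0) (Or.inl hKt)]
                ring
            _ ≤ _ := ENNReal.div_le_div (measure_mono (ball_subset_ball hs.1.le))
                (ENNReal.ofReal_le_ofReal hpow)
      _ ≤ wolff n p σ x := lintegral_mono_set fun s hs => hr.trans hs.1
  have hKe0 : K ^ e ≠ 0 := by simp [hK0, hKt]
  have hKet : K ^ e ≠ ∞ := ENNReal.rpow_ne_top_of_nonneg he hKt
  calc h = (K ^ e * (K ^ e)⁻¹) * (2 * 2⁻¹) * h := by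
        rw [ENNReal.mul_inv_cancel hKe0 hKet, ENNReal.mul_inv_cancel two_ne_zero (by simp)]
        simp
    _ = (K ^ e * 2) * ((K ^ e)⁻¹ * h * 2⁻¹) := by ring
    _ ≤ _ := by gcongr

/-- For `2 < p < n`, `I_p σ ≤ C (W_p σ)^{p-1}` pointwise, with `C = C(p,n)`. -/
theorem stmt7 (n : ℕ) (hn : 2 ≤ n) (p : ℝ) (hp : 2 < p) (hpn : p < n) :
    ∃ C : ℝ, 0 < C ∧
      ∀ σ : Measure (EuclideanSpace ℝ (Fin n)), IsLocallyFiniteMeasure σ →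
        ∀ x : EuclideanSpace ℝ (Fin n),
          riesz n p σ x ≤ ENNReal.ofReal C * wolff n p σ x ^ (p - 1) := by
  have hq : 0 < p - 1 := by linarith
  set A := ENNReal.ofReal (2 ^ ((n : ℝ) - p)) ^ (1 / (p - 1)) * 2
  have hA : A ≠ ∞ := ENNReal.mul_ne_top
    (ENNReal.rpow_ne_top_of_nonneg (by positivity) ENNReal.ofReal_ne_top) (by simp)
  set D := ENNReal.ofReal (n - p) * A ^ (p - 2)
  have hD : D ≠ ∞ := ENNReal.mul_ne_top ENNReal.ofReal_ne_top
    (ENNReal.rpow_ne_top_of_nonneg (by linarith) hA)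
  refine ⟨D.toReal + 1, by positivity, fun σ _ x => ?_⟩
  have hDC : D ≤ ENNReal.ofReal (D.toReal + 1) :=
    ENNReal.le_ofReal_iff_toReal_le hD (by positivity) |>.2 (by linarith)
  refine le_trans ?_ (mul_le_mul_left hDC _)
  set W := wolff n p σ x
  have hball : Measurable fun r : ℝ => σ (ball x r) :=
    Monotone.measurable fun r s hrs => measure_mono (ball_subset_ball hrs)
  calc riesz n p σ x
      ≤ ENNReal.ofReal (n - p) *
          ∫⁻ r in Ioi (0 : ℝ), σ (ball x r) * ENNReal.ofReal (r ^ (p - n - 1)) :=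
        riesz_le_lintegral_ball hpn σ x
    _ ≤ ENNReal.ofReal (n - p) * ∫⁻ r in Ioi (0 : ℝ), (A * W) ^ (p - 2) *
          ((σ (ball x r) / ENNReal.ofReal (r ^ ((n : ℝ) - p))) ^ (1 / (p - 1)) *
            ENNReal.ofReal (1 / r)) := by
        refine mul_le_mul_right (setLIntegral_mono' measurableSet_Ioi fun r hr => ?_) _
        have hr : 0 < r := hr
        have hpow : ENNReal.ofReal (r ^ (p - n - 1)) =
            (ENNReal.ofReal (r ^ ((n : ℝ) - p)))⁻¹ * ENNReal.ofReal (1 / r) := by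
          rw [← ENNReal.ofReal_inv_of_pos (by positivity), ← ENNReal.ofReal_mul (by positivity),
            ← Real.rpow_neg hr.le, neg_sub, Real.rpow_sub_one hr.ne', div_eq_mul_one_div]
        rw [hpow, ← mul_assoc, ← mul_assoc, ← div_eq_mul_inv]
        refine mul_le_mul_left ?_ _
        set t := σ (ball x r) / ENNReal.ofReal (r ^ ((n : ℝ) - p)) with ht
        calc t = (t ^ (1 / (p - 1))) ^ ((p - 2) + 1) := by
              rw [← ENNReal.rpow_mul, show 1 / (p - 1) * (p - 2 + 1) = 1 by field_simp; ring,
                ENNReal.rpow_one]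
          _ = (t ^ (1 / (p - 1))) ^ (p - 2) * t ^ (1 / (p - 1)) := by
              rw [ENNReal.rpow_add_of_nonneg _ _ (by linarith) zero_le_one, ENNReal.rpow_one]
          _ ≤ _ := mul_le_mul_left (ENNReal.rpow_le_rpow
              (rpow_ball_le_wolff (by linarith) hpn σ x hr) (by linarith)) _
    _ = ENNReal.ofReal (n - p) * ((A * W) ^ (p - 2) * W) := by
        have hmeas : Measurable fun r : ℝ =>
            (σ (ball x r) / ENNReal.ofReal (r ^ ((n : ℝ) - p))) ^ (1 / (p - 1)) *
              ENNReal.ofReal (1 / r) :=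
          ((hball.div (by fun_prop)).pow_const _).mul (by fun_prop)
        rw [lintegral_const_mul _ hmeas]
        rfl
    _ = D * W ^ (p - 1) := by
        rw [ENNReal.mul_rpow_of_nonneg _ _ (by linarith : 0 ≤ p - 2),
          show p - 1 = (p - 2) + 1 by ring,
          ENNReal.rpow_add_of_nonneg _ _ (by linarith) zero_le_one, ENNReal.rpow_one]
        ring
end

section
/- Let n ≥ 2 and 1 < p ≤ 2 with p < n. There is a constant C depending only on p and n such that for every positive Radon measure σ on ℝⁿ and every x ∈ ℝⁿ, (W_p σ(x))^{p−1} ≤ C·I_p σ(x). -/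
open MeasureTheory Metric Set
open scoped ENNReal NNReal

/-- Each normalized ball mass in the Wolff potential is at most the Riesz potential. -/
theorem measure_ball_div_le_riesz {n : ℕ} {p : ℝ} (hpn : p < n)
    (σ : Measure (EuclideanSpace ℝ (Fin n))) (x : EuclideanSpace ℝ (Fin n)) {r : ℝ}
    (hr : 0 < r) :
    σ (ball x r) / ENNReal.ofReal (r ^ ((n : ℝ) - p)) ≤ riesz n p σ x := by
  have hs : 0 < (n : ℝ) - p := sub_pos.2 hpn
  calc σ (ball x r) / ENNReal.ofReal (r ^ ((n : ℝ) - p))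
      = ∫⁻ _ in ball x r, ENNReal.ofReal r ^ (p - (n : ℝ)) ∂σ := by
        rw [setLIntegral_const, ← neg_sub (n : ℝ) p, ENNReal.rpow_neg, ENNReal.ofReal_rpow_of_pos hr,
          div_eq_mul_inv, mul_comm]
    _ ≤ ∫⁻ y in ball x r, ENNReal.ofReal ‖x - y‖ ^ (p - (n : ℝ)) ∂σ := by
        refine setLIntegral_mono' measurableSet_ball fun y hy => ?_
        rw [← neg_sub (n : ℝ) p, ENNReal.rpow_neg, ENNReal.rpow_neg]
        have hxy : ‖x - y‖ ≤ r := by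
          rw [← dist_eq_norm, dist_comm]
          exact (mem_ball.1 hy).le
        gcongr
    _ ≤ riesz n p σ x := setLIntegral_le_lintegral _ _

/-- The tail integral of `r ^ (-s - 1)` over `(t, ∞)` is at most `t ^ (-s) / s`. -/
theorem lintegral_Ioi_rpow_le {s t : ℝ} (hs : 0 < s) (ht : 0 ≤ t) :
    ∫⁻ r in Ioi t, ENNReal.ofReal (r ^ (-s - 1)) ≤
      ENNReal.ofReal (1 / s) * ENNReal.ofReal t ^ (-s) := by
  rcases ht.eq_or_lt with rfl | ht
  · rw [ENNReal.ofReal_zero, ENNReal.zero_rpow_of_neg (by linarith),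
      ENNReal.mul_top (by simpa using hs)]
    exact le_top
  · rw [← ofReal_integral_eq_lintegral_ofReal
      (integrableOn_Ioi_rpow_of_lt (by linarith) ht)
      ((ae_restrict_iff' measurableSet_Ioi).2 <| .of_forall fun r hr =>
        Real.rpow_nonneg (ht.trans hr).le _),
      integral_Ioi_rpow_of_lt (by linarith) ht, ENNReal.ofReal_rpow_of_pos ht,
      ← ENNReal.ofReal_mul (by positivity)]
    apply le_of_eq
    congr 1
    rw [sub_add_cancel]
    field_simp

/-- The linear (exponent one) Wolff-type integral is controlled by the Riesz potential. -/
theorem lintegral_measure_ball_div_le_riesz {n : ℕ} {p : ℝ} (hpn : p < n)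
    (σ : Measure (EuclideanSpace ℝ (Fin n))) [SFinite σ] (x : EuclideanSpace ℝ (Fin n)) :
    ∫⁻ r in Ioi (0 : ℝ),
      σ (ball x r) / ENNReal.ofReal (r ^ ((n : ℝ) - p)) * ENNReal.ofReal (1 / r) ≤
      ENNReal.ofReal (1 / ((n : ℝ) - p)) * riesz n p σ x := by
  have hs : 0 < (n : ℝ) - p := sub_pos.2 hpn
  set s := (n : ℝ) - p with hsdef
  let S : Set (ℝ × EuclideanSpace ℝ (Fin n)) := {z | dist z.2 x < z.1}
  have hS : MeasurableSet S :=
    measurableSet_lt (measurable_snd.dist measurable_const) measurable_fst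
  let g : ℝ × EuclideanSpace ℝ (Fin n) → ℝ≥0∞ :=
    S.indicator fun z => ENNReal.ofReal (z.1 ^ (-s - 1))
  have hg : Measurable g := by
    refine Measurable.indicator ?_ hS
    fun_prop
  calc ∫⁻ r in Ioi (0 : ℝ), σ (ball x r) / ENNReal.ofReal (r ^ s) * ENNReal.ofReal (1 / r)
      = ∫⁻ r in Ioi (0 : ℝ), ∫⁻ y, g (r, y) ∂σ := by
        refine setLIntegral_congr_fun measurableSet_Ioi fun r hr => ?_
        have hr : 0 < r := hr
        have hgr : (fun y => g (r, y)) =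
            (ball x r).indicator fun _ => ENNReal.ofReal (r ^ (-s - 1)) := by
          ext y
          simp only [g, S, indicator, mem_ofPred_eq, mem_ball]
        rw [hgr, lintegral_indicator_const measurableSet_ball, div_eq_mul_inv,
          ← ENNReal.ofReal_inv_of_pos (by positivity), mul_assoc,
          ← ENNReal.ofReal_mul (by positivity), mul_comm, Real.rpow_sub_one hr.ne',
          Real.rpow_neg hr.le, mul_one_div]
    _ = ∫⁻ y, (∫⁻ r in Ioi (0 : ℝ), g (r, y)) ∂σ :=
        lintegral_lintegral_swap hg.aemeasurable
    _ ≤ ∫⁻ y, ENNReal.ofReal (1 / s) * ENNReal.ofReal ‖x - y‖ ^ (p - (n : ℝ)) ∂σ := by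
        refine lintegral_mono fun y => ?_
        have hgy : (fun r => g (r, y)) =
            (Ioi ‖x - y‖).indicator fun r => ENNReal.ofReal (r ^ (-s - 1)) := by
          ext r
          simp only [g, S, indicator, mem_ofPred_eq, mem_Ioi, dist_eq_norm, norm_sub_rev y x]
        calc ∫⁻ r in Ioi (0 : ℝ), g (r, y)
            ≤ ∫⁻ r, g (r, y) := setLIntegral_le_lintegral _ _
          _ = ∫⁻ r in Ioi ‖x - y‖, ENNReal.ofReal (r ^ (-s - 1)) := by
              rw [hgy, lintegral_indicator measurableSet_Ioi]
          _ ≤ _ := by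
              rw [← neg_sub (n : ℝ) p]
              exact lintegral_Ioi_rpow_le hs (norm_nonneg _)
    _ = ENNReal.ofReal (1 / s) * riesz n p σ x :=
        lintegral_const_mul' _ _ ENNReal.ofReal_ne_top

/-- For `1 < p ≤ 2`, `p < n`, `(W_p σ)^{p-1} ≤ C I_p σ` pointwise, with `C = C(p,n)`. -/
theorem stmt8 (n : ℕ) (hn : 2 ≤ n) (p : ℝ) (hp : 1 < p) (hp2 : p ≤ 2) (hpn : p < n) :
    ∃ C : ℝ, 0 < C ∧
      ∀ σ : Measure (EuclideanSpace ℝ (Fin n)), IsLocallyFiniteMeasure σ →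
        ∀ x : EuclideanSpace ℝ (Fin n),
          wolff n p σ x ^ (p - 1) ≤ ENNReal.ofReal C * riesz n p σ x := by
  have hs : 0 < (n : ℝ) - p := sub_pos.2 hpn
  have hp1 : 0 < p - 1 := sub_pos.2 hp
  have hq : 0 ≤ 1 / (p - 1) - 1 := by
    rw [sub_nonneg, le_div_iff₀ hp1]
    linarith
  refine ⟨(1 / ((n : ℝ) - p)) ^ (p - 1), by positivity, fun σ hσ x => ?_⟩
  rcases eq_or_ne (riesz n p σ x) ⊤ with hI | hI
  · rw [hI, ENNReal.mul_top (by simpa using Real.rpow_pos_of_pos (inv_pos.2 hs) _)]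
    exact le_top
  set I := riesz n p σ x with hIdef
  set q := 1 / (p - 1) with hqdef
  have hsplit (a : ℝ≥0∞) : a ^ q = a ^ (q - 1) * a := by
    conv_lhs => rw [← sub_add_cancel q 1]
    rw [ENNReal.rpow_add_of_nonneg _ _ hq zero_le_one, ENNReal.rpow_one]
  have hW : wolff n p σ x ≤ ENNReal.ofReal (1 / ((n : ℝ) - p)) * I ^ q := by
    calc wolff n p σ x
        ≤ ∫⁻ r in Ioi (0 : ℝ), I ^ (q - 1) *
            (σ (ball x r) / ENNReal.ofReal (r ^ ((n : ℝ) - p)) * ENNReal.ofReal (1 / r)) := by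
          refine setLIntegral_mono' measurableSet_Ioi fun r hr => ?_
          rw [hsplit, mul_assoc]
          gcongr
          exact measure_ball_div_le_riesz hpn σ x hr
      _ ≤ I ^ (q - 1) * (ENNReal.ofReal (1 / ((n : ℝ) - p)) * I) := by
          rw [lintegral_const_mul' _ _ (ENNReal.rpow_ne_top_of_nonneg hq hI)]
          gcongr
          exact lintegral_measure_ball_div_le_riesz hpn σ x
      _ = _ := by rw [hsplit]; ring
  calc wolff n p σ x ^ (p - 1)
      ≤ (ENNReal.ofReal (1 / ((n : ℝ) - p)) * I ^ q) ^ (p - 1) := by gcongr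
    _ = _ := by
      rw [ENNReal.mul_rpow_of_nonneg _ _ hp1.le, ← ENNReal.rpow_mul, hqdef,
        one_div_mul_cancel hp1.ne', ENNReal.rpow_one,
        ENNReal.ofReal_rpow_of_pos (by positivity)]
end

section
/- Let n ≥ 2 and 1 < p ≤ 2 with p < n. Let μ, σ be positive Radon measures on ℝⁿ and suppose I_p σ(x) ≤ C₂ for all x ∈ ℝⁿ. Then there is a constant C depending only on p and n such that for every x ∈ ℝⁿ and R > 0, ∫_{B(x,R)} ( W_p(μ|_{B(x,2R)})(y) )^{p−1} dσ(y) ≤ C·C₂·μ(B(x,2R)). -/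
open MeasureTheory Metric Set
open scoped ENNReal NNReal

/-- The tail integral of `r ^ (-a - 1)` over `(t, ∞)`, for `t > 0`. -/
theorem lintegral_Ioi_rpow_neg_sub_one {a t : ℝ} (ha : 0 < a) (ht : 0 < t) :
    ∫⁻ r in Ioi t, ENNReal.ofReal (r ^ (-a - 1)) =
      ENNReal.ofReal t ^ (-a) / ENNReal.ofReal a := by
  rw [← ofReal_integral_eq_lintegral_ofReal
    (integrableOn_Ioi_rpow_of_lt (by linarith) ht)
    ((ae_restrict_mem measurableSet_Ioi).mono fun r hr =>
      Real.rpow_nonneg (ht.le.trans (le_of_lt hr)) _),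
    integral_Ioi_rpow_of_lt (by linarith) ht, ENNReal.ofReal_rpow_of_pos ht,
    ← ENNReal.ofReal_div_of_pos ha]
  congr 1
  rw [sub_add_cancel, neg_div_neg_eq]

/-- For `t ≥ 0` the tail integral of `r ^ (-a - 1)` is at most `t ^ (-a) / a`, which is `∞` at
`t = 0`. -/
theorem lintegral_Ioi_rpow_neg_sub_one_le {a t : ℝ} (ha : 0 < a) (ht : 0 ≤ t) :
    ∫⁻ r in Ioi t, ENNReal.ofReal (r ^ (-a - 1)) ≤
      ENNReal.ofReal t ^ (-a) / ENNReal.ofReal a := by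
  rcases ht.eq_or_lt with rfl | ht
  · rw [ENNReal.ofReal_zero, ENNReal.zero_rpow_of_neg (neg_lt_zero.2 ha),
      ENNReal.top_div_of_ne_top ENNReal.ofReal_ne_top]
    exact le_top
  · exact (lintegral_Ioi_rpow_neg_sub_one ha ht).le

/-- The `L^q` norm with respect to `dr / r` of `f r / r ^ a` is controlled by the `L^1` norm when
`f` is monotone and `q ≥ 1`. -/
theorem lintegral_div_rpow_le_of_monotone {f : ℝ → ℝ≥0∞} (hf : Monotone f) {a q : ℝ}
    (ha : 0 < a) (hq : 1 ≤ q) :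
    ∫⁻ r in Ioi (0 : ℝ), (f r / ENNReal.ofReal (r ^ a)) ^ q * ENNReal.ofReal (1 / r) ≤
      ENNReal.ofReal a ^ (q - 1) *
        (∫⁻ r in Ioi (0 : ℝ), f r * ENNReal.ofReal (r ^ (-a - 1))) ^ q := by
  set J := ∫⁻ r in Ioi (0 : ℝ), f r * ENNReal.ofReal (r ^ (-a - 1))
  have hA0 : ENNReal.ofReal a ≠ 0 := by simpa using ha
  have hk : Measurable fun r : ℝ => ENNReal.ofReal (r ^ (-a - 1)) := by fun_prop
  have hsup : ∀ r : ℝ, 0 < r → f r / ENNReal.ofReal (r ^ a) ≤ ENNReal.ofReal a * J := by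
    intro r hr
    have h1 : f r * (ENNReal.ofReal r ^ (-a) / ENNReal.ofReal a) ≤ J := by
      rw [← lintegral_Ioi_rpow_neg_sub_one ha hr, ← lintegral_const_mul _ hk]
      calc ∫⁻ s in Ioi r, f r * ENNReal.ofReal (s ^ (-a - 1))
          ≤ ∫⁻ s in Ioi r, f s * ENNReal.ofReal (s ^ (-a - 1)) :=
            setLIntegral_mono' measurableSet_Ioi fun s hs => by gcongr; exact hf (le_of_lt hs)
        _ ≤ J := lintegral_mono_set (Ioi_subset_Ioi hr.le)
    have h2 : f r / ENNReal.ofReal (r ^ a) =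
        ENNReal.ofReal a * (f r * (ENNReal.ofReal r ^ (-a) / ENNReal.ofReal a)) := by
      rw [← ENNReal.ofReal_rpow_of_pos hr, ENNReal.rpow_neg, mul_left_comm,
        ENNReal.mul_div_cancel hA0 ENNReal.ofReal_ne_top, div_eq_mul_inv]
    rw [h2]
    gcongr
  calc ∫⁻ r in Ioi (0 : ℝ), (f r / ENNReal.ofReal (r ^ a)) ^ q * ENNReal.ofReal (1 / r)
      ≤ ∫⁻ r in Ioi (0 : ℝ), (ENNReal.ofReal a * J) ^ (q - 1) *
          (f r * ENNReal.ofReal (r ^ (-a - 1))) := by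
        refine setLIntegral_mono' measurableSet_Ioi fun r (hr : 0 < r) => ?_
        have h3 : f r * ENNReal.ofReal (r ^ (-a - 1)) =
            f r / ENNReal.ofReal (r ^ a) * ENNReal.ofReal (1 / r) := by
          rw [div_eq_mul_inv, mul_assoc, ← ENNReal.ofReal_inv_of_pos (by positivity),
            ← ENNReal.ofReal_mul (by positivity), Real.rpow_sub hr, Real.rpow_neg hr.le,
            Real.rpow_one, div_eq_mul_one_div]
        rw [h3, ← mul_assoc]
        gcongr
        calc (f r / ENNReal.ofReal (r ^ a)) ^ q
            = (f r / ENNReal.ofReal (r ^ a)) ^ (q - 1) * (f r / ENNReal.ofReal (r ^ a)) := by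
              conv_lhs => rw [← sub_add_cancel q 1]
              rw [ENNReal.rpow_add_of_nonneg _ _ (by linarith) zero_le_one, ENNReal.rpow_one]
          _ ≤ _ := by
              gcongr
              exact hsup r hr
    _ = (ENNReal.ofReal a * J) ^ (q - 1) * J := lintegral_const_mul _ (hf.measurable.mul hk)
    _ = ENNReal.ofReal a ^ (q - 1) * J ^ q := by
        rw [ENNReal.mul_rpow_of_nonneg _ _ (by linarith), mul_assoc]
        conv_rhs => rw [← sub_add_cancel q 1]
        rw [ENNReal.rpow_add_of_nonneg (q - 1) 1 (by linarith) zero_le_one, ENNReal.rpow_one,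
          sub_add_cancel]

/-- The average of ball measures against `r ^ (-a - 1) dr` is dominated by a Riesz-type integral. -/
theorem lintegral_measure_ball_mul_rpow_le {n : ℕ} {a : ℝ} (ha : 0 < a)
    (μ : Measure (EuclideanSpace ℝ (Fin n))) [SFinite μ] (y : EuclideanSpace ℝ (Fin n)) :
    ∫⁻ r in Ioi (0 : ℝ), μ (ball y r) * ENNReal.ofReal (r ^ (-a - 1)) ≤
      (∫⁻ z, ENNReal.ofReal ‖z - y‖ ^ (-a) ∂μ) / ENNReal.ofReal a := by
  have hk : Measurable fun r : ℝ => ENNReal.ofReal (r ^ (-a - 1)) := by fun_prop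
  have hS : MeasurableSet {x : ℝ × EuclideanSpace ℝ (Fin n) | ‖x.2 - y‖ < x.1} :=
    measurableSet_lt (by fun_prop) (by fun_prop)
  calc ∫⁻ r in Ioi (0 : ℝ), μ (ball y r) * ENNReal.ofReal (r ^ (-a - 1))
      = ∫⁻ r in Ioi (0 : ℝ), ∫⁻ z, {x : ℝ × EuclideanSpace ℝ (Fin n) |
          ‖x.2 - y‖ < x.1}.indicator (fun x => ENNReal.ofReal (x.1 ^ (-a - 1))) (r, z) ∂μ := by
        refine lintegral_congr fun r => ?_
        rw [mul_comm, ← lintegral_indicator_const measurableSet_ball]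
        refine lintegral_congr fun z => ?_
        simp only [indicator, mem_ball, dist_eq_norm, mem_ofPred_eq]
    _ = ∫⁻ z, (∫⁻ r in Ioi (0 : ℝ), {x : ℝ × EuclideanSpace ℝ (Fin n) |
          ‖x.2 - y‖ < x.1}.indicator (fun x => ENNReal.ofReal (x.1 ^ (-a - 1))) (r, z)) ∂μ :=
        lintegral_lintegral_swap ((hk.comp measurable_fst).indicator hS).aemeasurable
    _ ≤ ∫⁻ z, ENNReal.ofReal ‖z - y‖ ^ (-a) / ENNReal.ofReal a ∂μ := by
        refine lintegral_mono fun z => ?_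
        refine le_trans ?_ (lintegral_Ioi_rpow_neg_sub_one_le ha (norm_nonneg (z - y)))
        rw [← lintegral_indicator measurableSet_Ioi, ← lintegral_indicator measurableSet_Ioi]
        refine lintegral_mono fun r => ?_
        simp only [indicator, mem_Ioi, mem_ofPred_eq]
        split_ifs <;> simp
    _ = (∫⁻ z, ENNReal.ofReal ‖z - y‖ ^ (-a) ∂μ) / ENNReal.ofReal a := by
        simp only [div_eq_mul_inv]
        exact lintegral_mul_const _ (by fun_prop)

/-- For `1 < p ≤ 2` the Wolff potential raised to the power `p - 1` is dominated pointwise by the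
Riesz potential of order `p`. -/
theorem wolff_rpow_le_riesz {n : ℕ} {p : ℝ} (hp : 1 < p) (hp2 : p ≤ 2) (hpn : p < n)
    (μ : Measure (EuclideanSpace ℝ (Fin n))) [SFinite μ] (y : EuclideanSpace ℝ (Fin n)) :
    wolff n p μ y ^ (p - 1) ≤
      ENNReal.ofReal ((n - p) ^ (1 - p)) * ∫⁻ z, ENNReal.ofReal ‖z - y‖ ^ (p - (n : ℝ)) ∂μ := by
  have ha : 0 < (n : ℝ) - p := by linarith
  have hs : 0 < p - 1 := by linarith
  have hA0 : ENNReal.ofReal ((n : ℝ) - p) ≠ 0 := by simpa using ha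
  have hmono : Monotone fun r => μ (ball y r) := fun r s hrs => measure_mono (ball_subset_ball hrs)
  have hW := lintegral_div_rpow_le_of_monotone (q := 1 / (p - 1)) hmono ha
    (by rw [le_div_iff₀ hs]; linarith)
  have hJ := lintegral_measure_ball_mul_rpow_le ha μ y
  rw [neg_sub] at hJ
  calc wolff n p μ y ^ (p - 1)
      ≤ _ := ENNReal.rpow_le_rpow hW hs.le
    _ = ENNReal.ofReal ((n : ℝ) - p) ^ (2 - p) *
        ∫⁻ r in Ioi (0 : ℝ), μ (ball y r) * ENNReal.ofReal (r ^ (-((n : ℝ) - p) - 1)) := by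
        rw [ENNReal.mul_rpow_of_nonneg _ _ hs.le, ← ENNReal.rpow_mul, ← ENNReal.rpow_mul,
          one_div_mul_cancel hs.ne', ENNReal.rpow_one, sub_mul, one_div_mul_cancel hs.ne']
        congr 2
        ring
    _ ≤ ENNReal.ofReal ((n : ℝ) - p) ^ (2 - p) *
        ((∫⁻ z, ENNReal.ofReal ‖z - y‖ ^ (p - (n : ℝ)) ∂μ) / ENNReal.ofReal (n - p)) := by
        rw [neg_sub]
        gcongr
    _ = _ := by
        rw [← ENNReal.ofReal_rpow_of_pos ha, show 1 - p = (2 - p) + -1 by ring,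
          ENNReal.rpow_add _ _ hA0 ENNReal.ofReal_ne_top, ENNReal.rpow_neg_one, div_eq_mul_inv]
        ring

/-- If `1 < p ≤ 2 < n` (well, `p < n`) and `I_p σ ≤ C₂` everywhere, then
`∫_{B(x,R)} (W_p (μ|_{B(x,2R)}))^{p-1} dσ ≤ C C₂ μ(B(x,2R))` with `C = C(p,n)`. -/
theorem stmt9 (n : ℕ) (hn : 2 ≤ n) (p : ℝ) (hp : 1 < p) (hp2 : p ≤ 2) (hpn : p < n) :
    ∃ C : ℝ, 0 < C ∧
      ∀ μ σ : Measure (EuclideanSpace ℝ (Fin n)),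
        IsLocallyFiniteMeasure μ → IsLocallyFiniteMeasure σ →
        ∀ C₂ : ℝ, (∀ x : EuclideanSpace ℝ (Fin n), riesz n p σ x ≤ ENNReal.ofReal C₂) →
          ∀ (x : EuclideanSpace ℝ (Fin n)) (R : ℝ), 0 < R →
            ∫⁻ y in ball x R, wolff n p (μ.restrict (ball x (2 * R))) y ^ (p - 1) ∂σ ≤
              ENNReal.ofReal (C * C₂) * μ (ball x (2 * R)) := by
  have ha : 0 < (n : ℝ) - p := by linarith
  refine ⟨(n - p) ^ (1 - p), Real.rpow_pos_of_pos ha _, ?_⟩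
  intro μ σ hμ hσ C₂ hC₂ x R hR
  have : IsFiniteMeasure (μ.restrict (ball x (2 * R))) := ⟨by
    rw [Measure.restrict_apply_univ]
    exact measure_ball_lt_top⟩
  calc ∫⁻ y in ball x R, wolff n p (μ.restrict (ball x (2 * R))) y ^ (p - 1) ∂σ
      ≤ ∫⁻ y, wolff n p (μ.restrict (ball x (2 * R))) y ^ (p - 1) ∂σ :=
        setLIntegral_le_lintegral _ _
    _ ≤ ∫⁻ y, ENNReal.ofReal ((n - p) ^ (1 - p)) *
          ∫⁻ z in ball x (2 * R), ENNReal.ofReal ‖z - y‖ ^ (p - (n : ℝ)) ∂μ ∂σ :=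
        lintegral_mono fun y => wolff_rpow_le_riesz hp hp2 hpn _ y
    _ = ENNReal.ofReal ((n - p) ^ (1 - p)) *
          ∫⁻ y, ∫⁻ z in ball x (2 * R), ENNReal.ofReal ‖z - y‖ ^ (p - (n : ℝ)) ∂μ ∂σ :=
        lintegral_const_mul' _ _ ENNReal.ofReal_ne_top
    _ = ENNReal.ofReal ((n - p) ^ (1 - p)) * ∫⁻ z in ball x (2 * R), riesz n p σ z ∂μ := by
        rw [lintegral_lintegral_swap]
        · rfl
        · exact Measurable.aemeasurable (by fun_prop)
    _ ≤ ENNReal.ofReal ((n - p) ^ (1 - p)) *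
          ∫⁻ _ in ball x (2 * R), ENNReal.ofReal C₂ ∂μ := by
        gcongr with z
        exact hC₂ z
    _ = ENNReal.ofReal ((n - p) ^ (1 - p) * C₂) * μ (ball x (2 * R)) := by
        rw [setLIntegral_const, ← mul_assoc, ENNReal.ofReal_mul (Real.rpow_nonneg ha.le _)]
end

section
/- Let n ≥ 2, 1 < p < n, and 0 < δ < p − 1. Let μ be a positive Radon measure on ℝⁿ with μ(B(x,R)) ≤ M·R^{n−p} for all x ∈ ℝⁿ and R > 0. Then there is a constant C depending only on n, p, and δ such that for all z ∈ ℝⁿ and r > 0, ∫_{B(z,r)} ( I₁ μ(y) )^{(p−δ)/(p−1)} dy ≤ C · M^{(p−δ)/(p−1)} · r^{n−p+δ}. -/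
open MeasureTheory Metric Set
open scoped ENNReal NNReal

/-- On the annulus `a ≤ ‖x - w‖ ≤ 2a` the kernel `‖x - w‖^{-s}` integrates to at most a constant
times `a^{d-s}` when the mass of balls grows like `R^d`. -/
lemma setLIntegral_annulus_norm_rpow_le {E : Type*} [NormedAddCommGroup E] [MeasurableSpace E]
    [BorelSpace E] {σ : Measure E} {A : ℝ≥0∞} {s d a : ℝ} {x : E} (hs : 0 ≤ s)
    (ha : 0 < a) (hσ : ∀ R : ℝ, 0 < R → σ (ball x R) ≤ A * ENNReal.ofReal R ^ d) :
    ∫⁻ w in {w | a ≤ ‖x - w‖ ∧ ‖x - w‖ ≤ 2 * a}, ENNReal.ofReal ‖x - w‖ ^ (-s) ∂σ ≤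
      A * ENNReal.ofReal (4 ^ d * a ^ (d - s)) := by
  have hnorm : Measurable fun w : E => ‖x - w‖ :=
    (continuous_const.sub continuous_id).norm.measurable
  have hmeas : MeasurableSet {w : E | a ≤ ‖x - w‖ ∧ ‖x - w‖ ≤ 2 * a} :=
    hnorm measurableSet_Icc
  calc _ ≤ ∫⁻ _ in {w | a ≤ ‖x - w‖ ∧ ‖x - w‖ ≤ 2 * a}, ENNReal.ofReal a ^ (-s) ∂σ := by
        refine setLIntegral_mono' hmeas fun w hw => ?_
        rw [ENNReal.rpow_neg, ENNReal.rpow_neg]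
        gcongr
        exact hw.1
    _ = ENNReal.ofReal a ^ (-s) * σ {w | a ≤ ‖x - w‖ ∧ ‖x - w‖ ≤ 2 * a} := by
        rw [setLIntegral_const]
    _ ≤ ENNReal.ofReal a ^ (-s) * (A * ENNReal.ofReal (4 * a) ^ d) := by
        gcongr
        refine (measure_mono fun w hw => ?_).trans (hσ (4 * a) (by positivity))
        rw [mem_ball, dist_comm, dist_eq_norm]
        linarith [hw.2]
    _ = A * ENNReal.ofReal (4 ^ d * a ^ (d - s)) := by
        rw [ENNReal.ofReal_rpow_of_pos ha, ENNReal.ofReal_rpow_of_pos (by positivity),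
          mul_left_comm, ← ENNReal.ofReal_mul (by positivity),
          Real.mul_rpow (by norm_num) ha.le, sub_eq_add_neg, Real.rpow_add ha]
        ring_nf

lemma setLIntegral_iUnion_annulus_norm_rpow_le {E : Type*} [NormedAddCommGroup E]
    [MeasurableSpace E] [BorelSpace E] {σ : Measure E} {A : ℝ≥0∞} {s d a κ : ℝ} {x : E}
    (hs : 0 ≤ s) (ha : 0 < a) (hκ : 0 < κ)
    (hσ : ∀ R : ℝ, 0 < R → σ (ball x R) ≤ A * ENNReal.ofReal R ^ d) :
    ∫⁻ w in ⋃ j : ℕ, {w | a * κ ^ j ≤ ‖x - w‖ ∧ ‖x - w‖ ≤ 2 * (a * κ ^ j)},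
        ENNReal.ofReal ‖x - w‖ ^ (-s) ∂σ ≤
      ENNReal.ofReal (4 ^ d) * (1 - ENNReal.ofReal (κ ^ (d - s)))⁻¹ * A *
        ENNReal.ofReal a ^ (d - s) := by
  calc _ ≤ ∑' j : ℕ, A * ENNReal.ofReal (4 ^ d * (a * κ ^ j) ^ (d - s)) :=
        (lintegral_iUnion_le _ _).trans <| ENNReal.tsum_le_tsum fun j =>
          setLIntegral_annulus_norm_rpow_le hs (by positivity) hσ
    _ = ∑' j : ℕ, (ENNReal.ofReal (4 ^ d) * A * ENNReal.ofReal a ^ (d - s)) *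
          ENNReal.ofReal (κ ^ (d - s)) ^ j := by
        congr 1 with j
        rw [Real.mul_rpow ha.le (by positivity), ENNReal.ofReal_mul (by positivity),
          ENNReal.ofReal_mul (by positivity), ENNReal.ofReal_rpow_of_pos ha,
          ← ENNReal.ofReal_pow (by positivity), ← Real.rpow_natCast, ← Real.rpow_natCast,
          ← Real.rpow_mul hκ.le, ← Real.rpow_mul hκ.le, mul_comm (j : ℝ)]
        ring
    _ = _ := by
        rw [ENNReal.tsum_mul_left, ENNReal.tsum_geometric]
        ring

lemma setLIntegral_ball_norm_rpow_le {s d : ℝ} (hs : 0 ≤ s) (hsd : s < d) :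
    ∃ C : ℝ≥0∞, C ≠ ∞ ∧ ∀ {E : Type*} [NormedAddCommGroup E] [MeasurableSpace E] [BorelSpace E]
      {σ : Measure E} {A : ℝ≥0∞} {x : E} {ρ : ℝ}, A ≠ ∞ → 0 < ρ →
      (∀ R : ℝ, 0 < R → σ (ball x R) ≤ A * ENNReal.ofReal R ^ d) →
      ∫⁻ w in ball x ρ, ENNReal.ofReal ‖x - w‖ ^ (-s) ∂σ ≤
        C * A * ENNReal.ofReal ρ ^ (d - s) := by
  refine ⟨ENNReal.ofReal (4 ^ d) * (1 - ENNReal.ofReal ((1 / 2 : ℝ) ^ (d - s)))⁻¹, ?_, ?_⟩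
  · refine ENNReal.mul_ne_top ENNReal.ofReal_ne_top (ENNReal.inv_ne_top.2 ?_)
    rw [Ne, tsub_eq_zero_iff_le, not_le, ENNReal.ofReal_lt_one]
    exact Real.rpow_lt_one (by norm_num) (by norm_num) (by linarith)
  intro E _ _ _ σ A x ρ hA hρ hσ
  have hx : σ {x} = 0 := by
    have hlim : Filter.Tendsto (fun R : ℝ => A * ENNReal.ofReal R ^ d)
        (nhdsWithin 0 (Ioi 0)) (nhds (A * ENNReal.ofReal 0 ^ d)) := by
      refine ENNReal.Tendsto.const_mul ?_ (Or.inr hA)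
      refine Filter.Tendsto.mono_left ?_ nhdsWithin_le_nhds
      exact ((ENNReal.continuous_rpow_const (y := d)).comp ENNReal.continuous_ofReal).tendsto 0
    rw [ENNReal.ofReal_zero, ENNReal.zero_rpow_of_pos (by linarith), mul_zero] at hlim
    refine le_antisymm (ge_of_tendsto hlim ?_) zero_le
    filter_upwards [self_mem_nhdsWithin] with R hR
    exact (measure_mono (singleton_subset_iff.2 (mem_ball_self hR))).trans (hσ R hR)
  have hcov : ball x ρ ⊆ {x} ∪
      ⋃ j : ℕ, {w | ρ / 2 * (1 / 2) ^ j ≤ ‖x - w‖ ∧ ‖x - w‖ ≤ 2 * (ρ / 2 * (1 / 2) ^ j)} := by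
    intro w hw
    rcases eq_or_ne w x with rfl | hne
    · exact Or.inl rfl
    right
    have hpos : 0 < ‖x - w‖ := norm_pos_iff.2 (sub_ne_zero.2 hne.symm)
    rw [mem_ball, dist_comm, dist_eq_norm] at hw
    obtain ⟨j, hj1, hj2⟩ := exists_nat_pow_near_of_lt_one (div_pos hpos hρ)
      ((div_le_one hρ).2 hw.le) (y := (1 / 2 : ℝ)) (by norm_num) (by norm_num)
    rw [lt_div_iff₀ hρ, pow_succ] at hj1
    rw [div_le_iff₀ hρ] at hj2
    exact mem_iUnion.2 ⟨j, by constructor <;> linarith⟩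
  have hx' : ∫⁻ w in {x}, ENNReal.ofReal ‖x - w‖ ^ (-s) ∂σ = 0 := by
    rw [Measure.restrict_zero_set hx, lintegral_zero_measure]
  refine ((lintegral_mono_set hcov).trans (lintegral_union_le _ _ _)).trans ?_
  rw [hx', zero_add]
  refine (setLIntegral_iUnion_annulus_norm_rpow_le hs (half_pos hρ) (by norm_num) hσ).trans ?_
  gcongr
  linarith

lemma setLIntegral_compl_ball_norm_rpow_le {s d : ℝ} (hs : 0 ≤ s) (hds : d < s) :
    ∃ C : ℝ≥0∞, C ≠ ∞ ∧ ∀ {E : Type*} [NormedAddCommGroup E] [MeasurableSpace E] [BorelSpace E]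
      {σ : Measure E} {A : ℝ≥0∞} {x : E} {ρ : ℝ}, 0 < ρ →
      (∀ R : ℝ, 0 < R → σ (ball x R) ≤ A * ENNReal.ofReal R ^ d) →
      ∫⁻ w in (ball x ρ)ᶜ, ENNReal.ofReal ‖x - w‖ ^ (-s) ∂σ ≤
        C * A * ENNReal.ofReal ρ ^ (d - s) := by
  refine ⟨ENNReal.ofReal (4 ^ d) * (1 - ENNReal.ofReal ((2 : ℝ) ^ (d - s)))⁻¹, ?_, ?_⟩
  · refine ENNReal.mul_ne_top ENNReal.ofReal_ne_top (ENNReal.inv_ne_top.2 ?_)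
    rw [Ne, tsub_eq_zero_iff_le, not_le, ENNReal.ofReal_lt_one]
    exact Real.rpow_lt_one_of_one_lt_of_neg (by norm_num) (by linarith)
  intro E _ _ _ σ A x ρ hρ hσ
  refine (lintegral_mono_set fun w hw => ?_).trans
    (setLIntegral_iUnion_annulus_norm_rpow_le hs hρ two_pos hσ)
  rw [mem_compl_iff, mem_ball, dist_comm, dist_eq_norm, not_lt] at hw
  obtain ⟨j, hj1, hj2⟩ := exists_nat_pow_near ((one_le_div hρ).2 hw) (one_lt_two (α := ℝ))
  rw [le_div_iff₀ hρ] at hj1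
  rw [div_lt_iff₀ hρ, pow_succ] at hj2
  exact mem_iUnion.2 ⟨j, by constructor <;> linarith⟩

/-- A splitting of the exponent `n - 1` for Hölder's inequality. -/
lemma exists_add_eq_of_mul_lt {n p Q : ℝ} (hp : 1 < p) (hpn : p < n) (hQ : 1 < Q)
    (hQp : Q * (p - 1) < p) :
    ∃ a b : ℝ, 0 ≤ a ∧ 0 ≤ b ∧ a + b = n - 1 ∧ a * Q < n ∧ b * Q < (n - p) * (Q - 1) := by
  have hS : 0 < n + (n - p) * (Q - 1) := by nlinarith
  have hlt : (n - 1) * Q < n + (n - p) * (Q - 1) := by nlinarith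
  have hQ0 : 0 < Q := by linarith
  have hθ : (n - 1) * Q / (n + (n - p) * (Q - 1)) < 1 := (div_lt_one hS).2 hlt
  have hm : 0 < (n - p) * (Q - 1) := by nlinarith
  refine ⟨(n - 1) * n / (n + (n - p) * (Q - 1)),
    (n - 1) * ((n - p) * (Q - 1)) / (n + (n - p) * (Q - 1)), ?_, ?_, ?_, ?_, ?_⟩
  · exact div_nonneg (by nlinarith) hS.le
  · exact div_nonneg (by nlinarith) hS.le
  · field_simp
  · calc _ = (n - 1) * Q / (n + (n - p) * (Q - 1)) * n := by ring
      _ < n := by nlinarith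
  · calc _ = (n - 1) * Q / (n + (n - p) * (Q - 1)) * ((n - p) * (Q - 1)) := by ring
      _ < _ := by nlinarith

/-- Hölder's inequality for a product kernel `k^{-(a+b)} = k^{-a} k^{-b}`. -/
lemma lintegral_rpow_neg_add_rpow_le {X : Type*} [MeasurableSpace X] {ν : Measure X}
    {k : X → ℝ≥0∞} (hk : Measurable k) {a b Q : ℝ} (ha : 0 ≤ a) (hb : 0 ≤ b) (hQ : 1 < Q) :
    (∫⁻ w, k w ^ (-(a + b)) ∂ν) ^ Q ≤
      (∫⁻ w, k w ^ (-(a * Q)) ∂ν) * (∫⁻ w, k w ^ (-(b * Q / (Q - 1))) ∂ν) ^ (Q - 1) := by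
  have hQ0 : 0 < Q := by linarith
  have hQ1 : 0 < Q - 1 := by linarith
  have hconj : Q.HolderConjugate (Q / (Q - 1)) := Real.HolderConjugate.conjExponent hQ
  have hsplit : ∀ w, k w ^ (-(a + b)) = k w ^ (-a) * k w ^ (-b) := fun w => by
    simp only [ENNReal.rpow_neg, ← ENNReal.inv_rpow]
    exact ENNReal.rpow_add_of_nonneg _ _ ha hb
  have h := ENNReal.lintegral_mul_le_Lp_mul_Lq ν hconj
    (f := fun w => k w ^ (-a)) (g := fun w => k w ^ (-b))
    (hk.pow_const _).aemeasurable (hk.pow_const _).aemeasurable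
  simp only [Pi.mul_apply, ← ENNReal.rpow_mul, ← hsplit] at h
  refine (ENNReal.rpow_le_rpow h hQ0.le).trans_eq ?_
  rw [ENNReal.mul_rpow_of_nonneg _ _ hQ0.le, ← ENNReal.rpow_mul, ← ENNReal.rpow_mul,
    one_div_mul_cancel hQ0.ne', ENNReal.rpow_one]
  congr 3
  · ext w; congr 1; ring
  · ext w; congr 1; ring
  · field_simp

lemma volume_ball_le_rpow (n : ℕ) (x : EuclideanSpace ℝ (Fin n)) {R : ℝ} (hR : 0 < R) :
    volume (ball x R) ≤
      volume (ball (0 : EuclideanSpace ℝ (Fin n)) 1) * ENNReal.ofReal R ^ (n : ℝ) := by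
  rw [Measure.addHaar_ball_of_pos volume x hR, finrank_euclideanSpace_fin, mul_comm,
    ENNReal.rpow_natCast, ENNReal.ofReal_pow hR.le]

lemma exists_lintegral_riesz_rpow_le (n : ℕ) {p Q : ℝ} (hp : 1 < p) (hpn : p < n) (hQ : 1 < Q)
    (hQp : Q * (p - 1) < p) :
    ∃ C : ℝ≥0∞, C ≠ ∞ ∧ ∀ (μ : Measure (EuclideanSpace ℝ (Fin n))) [IsLocallyFiniteMeasure μ]
      (A : ℝ≥0∞), A ≠ ∞ →
      (∀ (x : EuclideanSpace ℝ (Fin n)) (R : ℝ), 0 < R →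
        μ (ball x R) ≤ A * ENNReal.ofReal R ^ ((n : ℝ) - p)) →
      ∀ (z : EuclideanSpace ℝ (Fin n)) (r : ℝ), 0 < r →
        ∫⁻ y in ball z r, riesz n 1 μ y ^ Q ≤
          C * A ^ Q * ENNReal.ofReal r ^ ((n : ℝ) - (p - 1) * Q) := by
  obtain ⟨a, b, ha, hb, hab, haQ, hbQ⟩ := exists_add_eq_of_mul_lt hp hpn hQ hQp
  have hQ0 : 0 < Q := by linarith
  have hQ1 : 0 < Q - 1 := by linarith
  have hbQ' : b * Q / (Q - 1) < n - p := (div_lt_iff₀ hQ1).2 hbQ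
  obtain ⟨C₁, hC₁, hvol⟩ := setLIntegral_ball_norm_rpow_le (by positivity) haQ
  obtain ⟨C₂, hC₂, hnear⟩ := setLIntegral_ball_norm_rpow_le (by positivity) hbQ'
  obtain ⟨C₃, hC₃, hfar⟩ := setLIntegral_compl_ball_norm_rpow_le (s := n - 1) (d := n - p)
    (by linarith) (by linarith)
  set V : ℝ≥0∞ := volume (ball (0 : EuclideanSpace ℝ (Fin n)) 1)
  have hVtop : V ≠ ∞ := measure_ball_lt_top.ne
  set D : ℝ≥0∞ := C₁ * V * 3 ^ (n - a * Q) * 2 ^ (n - p) *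
    (C₂ * 3 ^ (n - p - b * Q / (Q - 1))) ^ (Q - 1) with hD
  refine ⟨2 ^ (Q - 1) * (D + C₃ ^ Q * V), ?_, ?_⟩
  · have h1 : (3 : ℝ≥0∞) ^ (n - a * Q) ≠ ∞ :=
      ENNReal.rpow_ne_top_of_nonneg (by linarith) (by norm_num)
    have h2 : (2 : ℝ≥0∞) ^ (n - p) ≠ ∞ :=
      ENNReal.rpow_ne_top_of_nonneg (by linarith) (by norm_num)
    have h3 : (3 : ℝ≥0∞) ^ (n - p - b * Q / (Q - 1)) ≠ ∞ :=
      ENNReal.rpow_ne_top_of_nonneg (by linarith) (by norm_num)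
    have h4 : (2 : ℝ≥0∞) ^ (Q - 1) ≠ ∞ :=
      ENNReal.rpow_ne_top_of_nonneg (by linarith) (by norm_num)
    have h5 : (C₂ * 3 ^ (n - p - b * Q / (Q - 1))) ^ (Q - 1) ≠ ∞ :=
      ENNReal.rpow_ne_top_of_nonneg hQ1.le (ENNReal.mul_ne_top hC₂ h3)
    have h6 : C₃ ^ Q ≠ ∞ := ENNReal.rpow_ne_top_of_nonneg hQ0.le hC₃
    finiteness
  intro μ _ A hA hμ z r hr
  set t := ENNReal.ofReal r with ht
  have ht0 : t ≠ 0 := by simpa [ht] using hr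
  have htop : t ≠ ∞ := ENNReal.ofReal_ne_top
  have h3t : ENNReal.ofReal (3 * r) = 3 * t := by
    rw [ENNReal.ofReal_mul (by norm_num), ENNReal.ofReal_ofNat]
  have h2t : ENNReal.ofReal (2 * r) = 2 * t := by
    rw [ENNReal.ofReal_mul (by norm_num), ENNReal.ofReal_ofNat]
  have h3r : 0 < 3 * r := by positivity
  set S := ball z (2 * r)
  let k : EuclideanSpace ℝ (Fin n) → EuclideanSpace ℝ (Fin n) → ℝ≥0∞ :=
    fun y w => ENNReal.ofReal ‖y - w‖
  have hk : ∀ y, Measurable (k y) := fun y => by fun_prop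
  set N : ℝ≥0∞ := C₂ * A * (3 * t) ^ (n - p - b * Q / (Q - 1)) with hN
  set F : ℝ≥0∞ := C₃ * A * t ^ (n - p - (n - 1)) with hF
  have hpt : ∀ y ∈ ball z r, riesz n 1 μ y ^ Q ≤
      2 ^ (Q - 1) * ((∫⁻ w in S, k y w ^ (-(a * Q)) ∂μ) * N ^ (Q - 1) + F ^ Q) := by
    intro y hy
    have hexp : (1 - n : ℝ) = -(a + b) := by linarith
    have hexp' : (1 - n : ℝ) = -(n - 1) := by ring
    have hriesz : riesz n 1 μ y = (∫⁻ w in S, k y w ^ (-(a + b)) ∂μ) +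
        ∫⁻ w in Sᶜ, k y w ^ (-((n : ℝ) - 1)) ∂μ := by
      rw [← hexp, ← hexp', lintegral_add_compl _ measurableSet_ball]
      rfl
    rw [hriesz]
    refine (ENNReal.rpow_add_le_mul_rpow_add_rpow _ _ hQ.le).trans ?_
    gcongr
    · refine (lintegral_rpow_neg_add_rpow_le (hk y) ha hb hQ).trans ?_
      gcongr
      rw [hN, ← h3t]
      refine (lintegral_mono_set (ball_subset_ball' ?_)).trans (hnear hA h3r (hμ y))
      rw [mem_ball, dist_comm] at hy
      linarith
    · refine (lintegral_mono_set (compl_subset_compl.2 (ball_subset_ball' ?_))).trans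
        (hfar hr (hμ y))
      rw [mem_ball] at hy
      linarith
  have hk2 : Measurable (Function.uncurry k) := by
    simp only [k, Function.uncurry_def]
    fun_prop
  have hfubini : ∫⁻ y in ball z r, ∫⁻ w in S, k y w ^ (-(a * Q)) ∂μ ≤
      C₁ * V * (3 * t) ^ (n - a * Q) * (A * (2 * t) ^ (n - p)) := by
    rw [lintegral_lintegral_swap (hk2.pow_const _).aemeasurable]
    calc _ ≤ ∫⁻ _ in S, C₁ * V * (3 * t) ^ (n - a * Q) ∂μ := by
          refine setLIntegral_mono' measurableSet_ball fun w hw => ?_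
          rw [← h3t]
          refine le_trans ?_ (hvol hVtop h3r fun R hR => volume_ball_le_rpow n w hR)
          simp only [k, norm_sub_rev _ w]
          refine lintegral_mono_set (ball_subset_ball' ?_)
          rw [mem_ball, dist_comm] at hw
          linarith
      _ ≤ _ := by
          rw [setLIntegral_const, ← h2t]
          gcongr
          exact hμ z _ (by positivity)
  have hAQ : A ^ Q = A * A ^ (Q - 1) := by
    conv_lhs => rw [show Q = 1 + (Q - 1) by ring]
    rw [ENNReal.rpow_add_of_nonneg _ _ zero_le_one hQ1.le, ENNReal.rpow_one]
  calc _ ≤ ∫⁻ y in ball z r,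
          2 ^ (Q - 1) * ((∫⁻ w in S, k y w ^ (-(a * Q)) ∂μ) * N ^ (Q - 1) + F ^ Q) :=
        setLIntegral_mono' measurableSet_ball hpt
    _ = 2 ^ (Q - 1) * ((∫⁻ y in ball z r, ∫⁻ w in S, k y w ^ (-(a * Q)) ∂μ) * N ^ (Q - 1) +
          F ^ Q * volume (ball z r)) := by
        have hm : Measurable fun y => ∫⁻ w in S, k y w ^ (-(a * Q)) ∂μ :=
          (hk2.pow_const _).lintegral_prod_right'
        rw [lintegral_const_mul _ ((hm.mul_const _).add_const _),
          lintegral_add_right _ measurable_const, lintegral_mul_const _ hm, setLIntegral_const]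
    _ ≤ 2 ^ (Q - 1) * (C₁ * V * (3 * t) ^ (n - a * Q) * (A * (2 * t) ^ (n - p)) * N ^ (Q - 1) +
          F ^ Q * (V * t ^ (n : ℝ))) := by
        gcongr
        exact volume_ball_le_rpow n z hr
    _ = _ := by
        have e1 : t ^ (n - (p - 1) * Q) = t ^ (n - a * Q) * t ^ (n - p) *
            t ^ ((n - p - b * Q / (Q - 1)) * (Q - 1)) := by
          rw [← ENNReal.rpow_add _ _ ht0 htop, ← ENNReal.rpow_add _ _ ht0 htop]
          congr 1
          field_simp
          linear_combination Q * hab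
        have e2 : t ^ (n - (p - 1) * Q) = t ^ ((n - p - (n - 1)) * Q) * t ^ (n : ℝ) := by
          rw [← ENNReal.rpow_add _ _ ht0 htop]
          congr 1
          ring
        have m3 : ∀ e : ℝ, (3 * t) ^ e = 3 ^ e * t ^ e := fun e =>
          ENNReal.mul_rpow_of_ne_top (by norm_num) htop e
        have m2 : ∀ e : ℝ, (2 * t) ^ e = 2 ^ e * t ^ e := fun e =>
          ENNReal.mul_rpow_of_ne_top (by norm_num) htop e
        rw [mul_assoc (2 ^ (Q - 1) * _), mul_assoc (2 ^ (Q - 1)), add_mul]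
        congr 2
        · rw [e1, hN, hD, m3, m2, m3, hAQ]
          simp only [ENNReal.mul_rpow_of_nonneg _ _ hQ1.le, ← ENNReal.rpow_mul]
          ring
        · rw [e2, hF]
          simp only [ENNReal.mul_rpow_of_nonneg _ _ hQ0.le, ← ENNReal.rpow_mul]
          ring

/-- Jensen's inequality on a set, in unnormalized form. -/
lemma setLIntegral_rpow_le_of_lt {X : Type*} [MeasurableSpace X] {ν : Measure X} {B : Set X}
    {f : X → ℝ≥0∞} (hf : AEMeasurable f ν) {q Q : ℝ} (hq : 0 < q) (hqQ : q < Q) :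
    ∫⁻ y in B, f y ^ q ∂ν ≤ (∫⁻ y in B, f y ^ Q ∂ν) ^ (q / Q) * ν B ^ (1 - q / Q) := by
  have hQ : 0 < Q := hq.trans hqQ
  have h := ENNReal.lintegral_mul_le_Lp_mul_Lq (ν.restrict B)
    (Real.HolderConjugate.conjExponent ((one_lt_div hq).2 hqQ))
    (f := fun y => f y ^ q) (g := fun _ => 1)
    (hf.restrict.pow_const _) aemeasurable_const
  simp only [Pi.mul_apply, mul_one, ENNReal.one_rpow, lintegral_one, Measure.restrict_apply_univ,
    ← ENNReal.rpow_mul, mul_div_cancel₀ _ hq.ne'] at h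
  refine h.trans_eq ?_
  congr 2
  · rw [one_div_div]
  · rw [Real.conjExponent]
    have : Q - q ≠ 0 := by linarith
    field_simp

lemma measurable_riesz (n : ℕ) (α : ℝ) (μ : Measure (EuclideanSpace ℝ (Fin n))) [SFinite μ] :
    Measurable (riesz n α μ) := by
  have : Measurable fun x : EuclideanSpace ℝ (Fin n) × EuclideanSpace ℝ (Fin n) =>
      ENNReal.ofReal ‖x.1 - x.2‖ ^ (α - (n : ℝ)) := by fun_prop
  exact this.lintegral_prod_right'

/-- Under `μ(B(x,R)) ≤ M R^{n-p}`, the Riesz potential `I₁μ` satisfies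
`∫_{B(z,r)} (I₁μ)^{(p-δ)/(p-1)} ≤ C M^{(p-δ)/(p-1)} r^{n-p+δ}` with `C = C(n,p,δ)`. -/
theorem stmt14 (n : ℕ) (hn : 2 ≤ n) (p δ : ℝ) (hp : 1 < p) (hpn : p < n)
    (hδ : 0 < δ) (hδp : δ < p - 1) :
    ∃ C : ℝ, 0 < C ∧
      ∀ μ : Measure (EuclideanSpace ℝ (Fin n)), IsLocallyFiniteMeasure μ →
        ∀ M : ℝ,
          (∀ (x : EuclideanSpace ℝ (Fin n)) (R : ℝ), 0 < R →
            μ (ball x R) ≤ ENNReal.ofReal (M * R ^ ((n : ℝ) - p))) →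
          ∀ (z : EuclideanSpace ℝ (Fin n)) (r : ℝ), 0 < r →
            ∫⁻ y in ball z r, riesz n 1 μ y ^ ((p - δ) / (p - 1)) ≤
              ENNReal.ofReal C * ENNReal.ofReal M ^ ((p - δ) / (p - 1)) *
                ENNReal.ofReal (r ^ ((n : ℝ) - p + δ)) := by
  have hp1 : 0 < p - 1 := by linarith
  set q := (p - δ) / (p - 1)
  have hq0 : 0 < q := div_pos (by linarith) hp1
  have hqp : q < p / (p - 1) := div_lt_div_of_pos_right (by linarith) hp1
  obtain ⟨Q, hQ, hQp⟩ := exists_between (max_lt hqp ((one_lt_div hp1).2 (by linarith)))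
  obtain ⟨hqQ, hQ1⟩ := max_lt_iff.1 hQ
  have hQ0 : 0 < Q := by linarith
  have hqQ1 : 0 < 1 - q / Q := sub_pos.2 ((div_lt_one hQ0).2 hqQ)
  obtain ⟨C, hC, hmain⟩ := exists_lintegral_riesz_rpow_le n hp hpn hQ1 ((lt_div_iff₀ hp1).1 hQp)
  set V : ℝ≥0∞ := volume (ball (0 : EuclideanSpace ℝ (Fin n)) 1)
  have hVtop : V ≠ ∞ := measure_ball_lt_top.ne
  set K : ℝ≥0∞ := C ^ (q / Q) * V ^ (1 - q / Q) with hK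
  have hKtop : K ≠ ∞ := ENNReal.mul_ne_top (ENNReal.rpow_ne_top_of_nonneg (by positivity) hC)
    (ENNReal.rpow_ne_top_of_nonneg hqQ1.le hVtop)
  refine ⟨K.toReal + 1, by positivity, fun μ _ M hμ z r hr => ?_⟩
  have hμ' : ∀ (x : EuclideanSpace ℝ (Fin n)) (R : ℝ), 0 < R →
      μ (ball x R) ≤ ENNReal.ofReal M * ENNReal.ofReal R ^ ((n : ℝ) - p) := fun x R hR => by
    rw [ENNReal.ofReal_rpow_of_pos hR, ← ENNReal.ofReal_mul' (by positivity)]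
    exact hμ x R hR
  have ht0 : ENNReal.ofReal r ≠ 0 := by simpa using hr
  have htop : ENNReal.ofReal r ≠ ∞ := ENNReal.ofReal_ne_top
  calc _ ≤ (∫⁻ y in ball z r, riesz n 1 μ y ^ Q) ^ (q / Q) * volume (ball z r) ^ (1 - q / Q) :=
        setLIntegral_rpow_le_of_lt (measurable_riesz n 1 μ).aemeasurable hq0 hqQ
    _ ≤ (C * ENNReal.ofReal M ^ Q * ENNReal.ofReal r ^ ((n : ℝ) - (p - 1) * Q)) ^ (q / Q) *
          (V * ENNReal.ofReal r ^ (n : ℝ)) ^ (1 - q / Q) := by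
        gcongr
        · exact hmain μ _ ENNReal.ofReal_ne_top hμ' z r hr
        · exact volume_ball_le_rpow n z hr
    _ = K * ENNReal.ofReal M ^ q * ENNReal.ofReal (r ^ ((n : ℝ) - p + δ)) := by
        have e1 : ENNReal.ofReal r ^ ((n : ℝ) - p + δ) =
            ENNReal.ofReal r ^ (((n : ℝ) - (p - 1) * Q) * (q / Q)) *
              ENNReal.ofReal r ^ ((n : ℝ) * (1 - q / Q)) := by
          rw [← ENNReal.rpow_add _ _ ht0 htop]
          congr 1
          have : (p - 1) * q = p - δ := mul_div_cancel₀ _ hp1.ne'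
          have hqQ' : Q * (q / Q) = q := mul_div_cancel₀ _ hQ0.ne'
          linear_combination (p - 1) * hqQ' + this
        rw [← ENNReal.ofReal_rpow_of_pos hr, e1]
        simp only [ENNReal.mul_rpow_of_nonneg _ _ hqQ1.le,
          ENNReal.mul_rpow_of_nonneg _ _ (div_pos hq0 hQ0).le, ← ENNReal.rpow_mul,
          mul_div_cancel₀ _ hQ0.ne', hK]
        ring
    _ ≤ _ := by
        gcongr
        exact (ENNReal.le_ofReal_iff_toReal_le hKtop (by positivity)).2 (by linarith)
end

section
/- Let n ≥ 2 and 1 < p < n. Define the dyadic Wolff potential W^d_p μ(x) = Σ_{k ∈ ℤ} Σ_{m ∈ ℤⁿ} (μ(Q_{k,m})/2^{k(n−p)})^{1/(p−1)} χ_{Q_{k,m}}(x) and its modified version W̃^d_p μ(x) = Σ_{k ∈ ℤ} Σ_{m ∈ ℤⁿ} (μ(Q*_{k,m})/2^{k(n−p)})^{1/(p−1)} χ_{Q_{k,m}}(x). Then there exist constants a > 0 and A > 0 depending only on p and n such that for every positive Radon measure μ on ℝⁿ and every x ∈ ℝⁿ, a·W^d_p μ(x) ≤ W_p μ(x) ≤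 A·W̃^d_p μ(x). -/
open MeasureTheory Metric Set
open scoped ENNReal NNReal

/-- The dyadic cube `Q_{k,m} = ∏ᵢ [2^k mᵢ, 2^k (mᵢ+1))` of side length `2^k`. -/
def dyadicCube (n : ℕ) (k : ℤ) (m : Fin n → ℤ) : Set (EuclideanSpace ℝ (Fin n)) :=
  {x | ∀ i, (2 : ℝ) ^ k * (m i : ℝ) ≤ x i ∧ x i < (2 : ℝ) ^ k * ((m i : ℝ) + 1)}

/-- The cube `Q*_{k,m} = ∏ᵢ [2^k (mᵢ-1), 2^k (mᵢ+2))`, concentric with `Q_{k,m}` and of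
side length `3·2^k`. -/
def dyadicStar (n : ℕ) (k : ℤ) (m : Fin n → ℤ) : Set (EuclideanSpace ℝ (Fin n)) :=
  {x | ∀ i, (2 : ℝ) ^ k * ((m i : ℝ) - 1) ≤ x i ∧ x i < (2 : ℝ) ^ k * ((m i : ℝ) + 2)}

/-- The dyadic Wolff potential
`W^d_p μ(x) = Σ_{k,m} (μ(Q_{k,m})/2^{k(n-p)})^{1/(p-1)} χ_{Q_{k,m}}(x)`. -/
noncomputable def wolffDyadic (n : ℕ) (p : ℝ) (μ : Measure (EuclideanSpace ℝ (Fin n)))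
    (x : EuclideanSpace ℝ (Fin n)) : ℝ≥0∞ :=
  ∑' (k : ℤ) (m : Fin n → ℤ),
    (μ (dyadicCube n k m) /
        ENNReal.ofReal ((2 : ℝ) ^ ((k : ℝ) * ((n : ℝ) - p)))) ^ (1 / (p - 1)) *
      (dyadicCube n k m).indicator (fun _ => (1 : ℝ≥0∞)) x

/-- The modified dyadic Wolff potential
`W̃^d_p μ(x) = Σ_{k,m} (μ(Q*_{k,m})/2^{k(n-p)})^{1/(p-1)} χ_{Q_{k,m}}(x)`. -/
noncomputable def wolffDyadicStar (n : ℕ) (p : ℝ) (μ : Measure (EuclideanSpace ℝ (Fin n)))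
    (x : EuclideanSpace ℝ (Fin n)) : ℝ≥0∞ :=
  ∑' (k : ℤ) (m : Fin n → ℤ),
    (μ (dyadicStar n k m) /
        ENNReal.ofReal ((2 : ℝ) ^ ((k : ℝ) * ((n : ℝ) - p)))) ^ (1 / (p - 1)) *
      (dyadicCube n k m).indicator (fun _ => (1 : ℝ≥0∞)) x

theorem lintegral_Ioi_eq_tsum_dyadic (f : ℝ → ℝ≥0∞) :
    ∫⁻ r in Ioi (0 : ℝ), f r =
      ∑' k : ℤ, ∫⁻ r in Ico ((2 : ℝ) ^ k) ((2 : ℝ) ^ (k + 1)), f r := by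
  have hU : Ioi (0 : ℝ) = ⋃ k : ℤ, Ico ((2 : ℝ) ^ k) ((2 : ℝ) ^ (k + 1)) := by
    ext r
    simp only [mem_Ioi, mem_iUnion]
    refine ⟨fun hr => exists_mem_Ico_zpow hr one_lt_two, ?_⟩
    rintro ⟨k, hk⟩
    exact lt_of_lt_of_le (by positivity) hk.1
  rw [hU]
  refine lintegral_iUnion (fun _ => measurableSet_Ico) ?_ f
  have hmono : Monotone fun k : ℤ => (2 : ℝ) ^ k := zpow_right_mono₀ one_le_two
  simpa using hmono.pairwise_disjoint_on_Ico_succ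

theorem div_ofReal_mul_rpow (M : ℝ≥0∞) {c b q : ℝ} (hc : 0 < c) (hb : 0 < b) (hq : 0 ≤ q) :
    (M / ENNReal.ofReal (c * b)) ^ q =
      ENNReal.ofReal (c ^ (-q)) * (M / ENNReal.ofReal b) ^ q := by
  have h : M / ENNReal.ofReal (c * b) = ENNReal.ofReal c⁻¹ * (M / ENNReal.ofReal b) := by
    rw [div_eq_mul_inv, div_eq_mul_inv, ← ENNReal.ofReal_inv_of_pos (mul_pos hc hb),
      ← ENNReal.ofReal_inv_of_pos hb, mul_inv, ENNReal.ofReal_mul (by positivity)]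
    ring
  rw [h, ENNReal.mul_rpow_of_nonneg _ _ hq,
    ENNReal.ofReal_rpow_of_nonneg (by positivity) hq, Real.inv_rpow hc.le, Real.rpow_neg hc.le]

/-- The index `m` of the dyadic cube of side length `2^k` containing `x`. -/
noncomputable def dyadicIndex (n : ℕ) (x : EuclideanSpace ℝ (Fin n)) (k : ℤ) : Fin n → ℤ :=
  fun i => ⌊x i / (2 : ℝ) ^ k⌋

theorem mem_dyadicCube_iff {n : ℕ} {x : EuclideanSpace ℝ (Fin n)} {k : ℤ} {m : Fin n → ℤ} :
    x ∈ dyadicCube n k m ↔ m = dyadicIndex n x k := by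
  have h2 : (0 : ℝ) < 2 ^ k := by positivity
  rw [eq_comm, funext_iff]
  refine forall_congr' fun i => ?_
  rw [dyadicIndex, Int.floor_eq_iff, le_div_iff₀ h2, div_lt_iff₀ h2, mul_comm, mul_comm _ (_ + 1)]

theorem tsum_mul_indicator_dyadicCube {n : ℕ} (x : EuclideanSpace ℝ (Fin n)) (k : ℤ)
    (g : (Fin n → ℤ) → ℝ≥0∞) :
    ∑' m, g m * (dyadicCube n k m).indicator (fun _ => (1 : ℝ≥0∞)) x =
      g (dyadicIndex n x k) := by
  rw [tsum_eq_single (dyadicIndex n x k)]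
  · rw [indicator_of_mem (mem_dyadicCube_iff.2 rfl), mul_one]
  · intro m hm
    rw [indicator_of_notMem (fun h => hm (mem_dyadicCube_iff.1 h)), mul_zero]

theorem ball_subset_dyadicStar {n : ℕ} {x : EuclideanSpace ℝ (Fin n)} {k : ℤ} {m : Fin n → ℤ}
    (hx : x ∈ dyadicCube n k m) {r : ℝ} (hr : r ≤ 2 ^ k) : ball x r ⊆ dyadicStar n k m := by
  intro y hy i
  have h1 : |y i - x i| < 2 ^ k := by
    have := PiLp.norm_apply_le (y - x) i
    rw [← dist_eq_norm] at this
    exact (this.trans_lt (mem_ball.1 hy)).trans_le hr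
  rw [abs_lt] at h1
  have h2 := hx i
  constructor <;> nlinarith

theorem dyadicCube_subset_ball {n : ℕ} {x : EuclideanSpace ℝ (Fin n)} {k : ℤ} {m : Fin n → ℤ}
    (hx : x ∈ dyadicCube n k m) {r : ℝ} (hr : 2 ^ (k + n) ≤ r) : dyadicCube n k m ⊆ ball x r := by
  intro y hy
  refine lt_of_lt_of_le ?_ hr
  have h2 : (0 : ℝ) < 2 ^ k := by positivity
  rw [EuclideanSpace.dist_eq, Real.sqrt_lt' (by positivity)]
  have hle : ∑ i, dist (y i) (x i) ^ 2 ≤ ∑ _i : Fin n, ((2 : ℝ) ^ k) ^ 2 := by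
    refine Finset.sum_le_sum fun i _ => ?_
    have h3 := hx i
    have h4 := hy i
    have : dist (y i) (x i) ≤ 2 ^ k := by
      rw [Real.dist_eq, abs_le]
      constructor <;> linarith
    gcongr
  refine hle.trans_lt ?_
  have hn : (n : ℝ) < 2 ^ n := by exact_mod_cast Nat.lt_two_pow_self
  have h1 : (1 : ℝ) ≤ 2 ^ n := one_le_pow₀ one_le_two
  rw [Finset.sum_const, Finset.card_univ, Fintype.card_fin, nsmul_eq_mul,
    zpow_add₀ two_ne_zero, zpow_natCast, mul_pow, mul_comm]
  refine mul_lt_mul_of_pos_left ?_ (by positivity)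
  nlinarith

theorem zpow_rpow_eq (k : ℤ) (s : ℝ) : ((2 : ℝ) ^ k) ^ s = 2 ^ ((k : ℝ) * s) := by
  rw [← Real.rpow_intCast, ← Real.rpow_mul zero_le_two]

theorem wolffDyadic_le_wolff {n : ℕ} {p : ℝ} (hp : 1 < p) (hpn : p < n)
    (μ : Measure (EuclideanSpace ℝ (Fin n))) (x : EuclideanSpace ℝ (Fin n)) :
    ENNReal.ofReal ((2 ^ (((n : ℝ) + 1) * (n - p))) ^ (-(1 / (p - 1))) * 2⁻¹) *
      wolffDyadic n p μ x ≤ wolff n p μ x := by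
  have hq : 0 ≤ 1 / (p - 1) := one_div_nonneg.2 (by linarith)
  simp only [wolffDyadic, tsum_mul_indicator_dyadicCube]
  rw [wolff, lintegral_Ioi_eq_tsum_dyadic, ← (Equiv.addRight (n : ℤ)).tsum_eq
    (fun k => ∫⁻ r in Ico ((2 : ℝ) ^ k) (2 ^ (k + 1)), _), ← ENNReal.tsum_mul_left]
  refine ENNReal.tsum_le_tsum fun k => ?_
  simp only [Equiv.coe_addRight]
  set M := μ (dyadicCube n k (dyadicIndex n x k))
  have hb : (0 : ℝ) < 2 ^ (k + n) := by positivity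
  have hbs : (2 : ℝ) ^ (k + n + 1) = 2 * 2 ^ (k + n) := by
    rw [zpow_add_one₀ two_ne_zero, mul_comm]
  calc _ = (M / ENNReal.ofReal (2 ^ (((n : ℝ) + 1) * (n - p)) * 2 ^ ((k : ℝ) * (n - p)))) ^
          (1 / (p - 1)) * ENNReal.ofReal (1 / 2 ^ (k + n + 1)) *
          volume (Ico ((2 : ℝ) ^ (k + n)) (2 ^ (k + n + 1))) := by
        rw [div_ofReal_mul_rpow _ (by positivity) (by positivity) hq, Real.volume_Ico, mul_assoc,
          ← ENNReal.ofReal_mul (by positivity), ENNReal.ofReal_mul (by positivity)]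
        have : 1 / 2 ^ (k + n + 1) * ((2 : ℝ) ^ (k + n + 1) - 2 ^ (k + n)) = 2⁻¹ := by
          rw [hbs]; field_simp; ring
        rw [this]
        ring
    _ = ∫⁻ _r in Ico ((2 : ℝ) ^ (k + n)) (2 ^ (k + n + 1)),
          (M / ENNReal.ofReal (2 ^ (((n : ℝ) + 1) * (n - p)) * 2 ^ ((k : ℝ) * (n - p)))) ^
          (1 / (p - 1)) * ENNReal.ofReal (1 / 2 ^ (k + n + 1)) := by
        rw [setLIntegral_const]
    _ ≤ _ := by
        refine setLIntegral_mono' measurableSet_Ico fun r hr => ?_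
        have hr0 : 0 < r := hb.trans_le hr.1
        have hrs : r ^ ((n : ℝ) - p) ≤
            2 ^ (((n : ℝ) + 1) * (n - p)) * 2 ^ ((k : ℝ) * (n - p)) := by
          have := Real.rpow_le_rpow hr0.le hr.2.le (sub_nonneg.2 hpn.le)
          rw [zpow_rpow_eq] at this
          rw [← Real.rpow_add two_pos]
          refine this.trans_eq ?_
          push_cast
          ring_nf
        have hM : M ≤ μ (ball x r) :=
          measure_mono (dyadicCube_subset_ball (mem_dyadicCube_iff.2 rfl) hr.1)
        have := hr.2.le
        gcongr

theorem wolff_le_wolffDyadicStar {n : ℕ} {p : ℝ} (hp : 1 < p) (hpn : p < n)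
    (μ : Measure (EuclideanSpace ℝ (Fin n))) (x : EuclideanSpace ℝ (Fin n)) :
    wolff n p μ x ≤
      ENNReal.ofReal ((2 ^ (-((n : ℝ) - p))) ^ (-(1 / (p - 1)))) * wolffDyadicStar n p μ x := by
  have hq : 0 ≤ 1 / (p - 1) := one_div_nonneg.2 (by linarith)
  simp only [wolffDyadicStar, tsum_mul_indicator_dyadicCube]
  rw [wolff, lintegral_Ioi_eq_tsum_dyadic, ← (Equiv.addRight (1 : ℤ)).tsum_eq
    (fun k => (_ / _ : ℝ≥0∞) ^ _), ← ENNReal.tsum_mul_left]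
  refine ENNReal.tsum_le_tsum fun k => ?_
  simp only [Equiv.coe_addRight]
  set M := μ (dyadicStar n (k + 1) (dyadicIndex n x (k + 1)))
  have hb : (0 : ℝ) < 2 ^ k := by positivity
  rw [← div_ofReal_mul_rpow _ (by positivity) (by positivity) hq]
  have hs : (2 : ℝ) ^ (-((n : ℝ) - p)) * 2 ^ (((k + 1 : ℤ) : ℝ) * (n - p)) =
      (2 ^ k) ^ ((n : ℝ) - p) := by
    rw [zpow_rpow_eq, ← Real.rpow_add two_pos]
    push_cast
    ring_nf
  rw [hs]
  calc _ ≤ ∫⁻ _r in Ico ((2 : ℝ) ^ k) (2 ^ (k + 1)),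
          (M / ENNReal.ofReal ((2 ^ k) ^ ((n : ℝ) - p))) ^ (1 / (p - 1)) *
            ENNReal.ofReal (1 / 2 ^ k) := by
        refine setLIntegral_mono' measurableSet_Ico fun r hr => ?_
        have hM : μ (ball x r) ≤ M :=
          measure_mono (ball_subset_dyadicStar (mem_dyadicCube_iff.2 rfl) hr.2.le)
        have hrs := Real.rpow_le_rpow hb.le hr.1 (sub_nonneg.2 hpn.le)
        have := hr.1
        gcongr
    _ = _ := by
        rw [setLIntegral_const, Real.volume_Ico, mul_assoc, ← ENNReal.ofReal_mul (by positivity)]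
        have : 1 / 2 ^ k * ((2 : ℝ) ^ (k + 1) - 2 ^ k) = 1 := by
          rw [zpow_add_one₀ two_ne_zero]; field_simp; ring
        rw [this, ENNReal.ofReal_one, mul_one]

/-- Comparison between the Wolff potential and its dyadic versions:
`a·W^d_p μ ≤ W_p μ ≤ A·W̃^d_p μ` with constants depending only on `p` and `n`. -/
theorem stmt15 (n : ℕ) (hn : 2 ≤ n) (p : ℝ) (hp : 1 < p) (hpn : p < n) :
    ∃ a A : ℝ, 0 < a ∧ 0 < A ∧
      ∀ μ : Measure (EuclideanSpace ℝ (Fin n)), IsLocallyFiniteMeasure μ →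
        ∀ x : EuclideanSpace ℝ (Fin n),
          ENNReal.ofReal a * wolffDyadic n p μ x ≤ wolff n p μ x ∧
            wolff n p μ x ≤ ENNReal.ofReal A * wolffDyadicStar n p μ x := by
  exact ⟨_, _, by positivity, by positivity, fun μ _ x =>
    ⟨wolffDyadic_le_wolff hp hpn μ x, wolff_le_wolffDyadicStar hp hpn μ x⟩⟩
end

section
/- Let n ≥ 2 and 1 < p < n, and let u : ℝⁿ → ℝ be continuously differentiable. Suppose there is A > 0 such that ‖|∇u|‖_{L^{p,∞}(B(x,R))} ≤ A·R^{(n−p)/p} for all x ∈ ℝⁿ and R > 0. Then there is a constant C depending only on n and p such that for every ball B = B(x,R), (1/|B|) ∫_B |u(y) − ū_B| dy ≤ C·A, where ū_B = (1/|B|) ∫_B u(y) dy; in particular, u has bounded mean oscillation. -/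
open MeasureTheory Metric Set
open scoped ENNReal NNReal

/-- The weak `L^q` (quasi-)norm of `f` over a set `S`:
`‖f‖_{L^{q,∞}(S)} = sup_{λ>0} λ · |{y ∈ S : |f(y)| > λ}|^{1/q}`. -/
noncomputable def weakNorm (n : ℕ) (q : ℝ) (f : EuclideanSpace ℝ (Fin n) → ℝ)
    (S : Set (EuclideanSpace ℝ (Fin n))) : ℝ≥0∞ :=
  ⨆ lam : {t : ℝ // 0 < t},
    ENNReal.ofReal lam.1 * volume {y | y ∈ S ∧ lam.1 < |f y|} ^ (1 / q)

section Poincare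

variable {E : Type*} [NormedAddCommGroup E] [NormedSpace ℝ E]

lemma enorm_sub_le_lintegral_segment {u : E → ℝ} (hu : ContDiff ℝ 1 u) (y z : E) :
    ‖u y - u z‖ₑ ≤ ‖y - z‖ₑ * ∫⁻ t in Icc (0 : ℝ) 1, ‖fderiv ℝ u (z + t • (y - z))‖ₑ := by
  have hc : ContDiff ℝ 1 fun t : ℝ => u (z + t • (y - z)) := by fun_prop
  have h := enorm_sub_le_lintegral_deriv_of_contDiffOn_Icc hc.contDiffOn (zero_le_one (α := ℝ))
  simp only [one_smul, zero_smul, add_zero, add_sub_cancel] at h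
  refine h.trans ?_
  rw [← lintegral_const_mul' _ _ enorm_ne_top]
  refine lintegral_mono fun t => ?_
  have h1 : HasDerivAt (fun t : ℝ => z + t • (y - z)) (y - z) t := by
    simpa using ((hasDerivAt_id t).smul_const (y - z)).const_add z
  have h2 := ((hu.differentiable one_ne_zero) (z + t • (y - z))).hasFDerivAt.comp_hasDerivAt t h1
  have h3 : deriv (fun t : ℝ => u (z + t • (y - z))) t
      = fderiv ℝ u (z + t • (y - z)) (y - z) := h2.deriv
  rw [h3, mul_comm]
  exact ContinuousLinearMap.le_opENorm _ _

variable [FiniteDimensional ℝ E] [MeasurableSpace E] [BorelSpace E]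
  (μ : Measure E) [μ.IsAddHaarMeasure]

/-- Change of variables `y ↦ w + t • y`, as an inequality, for `t ≥ 1 / 2`. -/
lemma lintegral_comp_add_smul_le {f : E → ℝ≥0∞} (hf : Measurable f) (w : E) {t : ℝ}
    (ht : 1 / 2 ≤ t) :
    ∫⁻ y, f (w + t • y) ∂μ ≤ 2 ^ Module.finrank ℝ E * ∫⁻ y, f y ∂μ := by
  have ht0 : 0 < t := by linarith
  have h1 : ∫⁻ y, f (w + t • y) ∂μ = ∫⁻ y, f (w + y) ∂(Measure.map (t • ·) μ) := by
    rw [lintegral_map (by fun_prop) (by fun_prop)]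
  rw [h1, Measure.map_addHaar_smul μ ht0.ne', lintegral_smul_measure,
    lintegral_add_left_eq_self f w, smul_eq_mul]
  gcongr
  rw [abs_of_pos (by positivity), ← inv_pow, ENNReal.ofReal_pow (by positivity)]
  gcongr
  rw [← ENNReal.ofReal_ofNat 2]
  apply ENNReal.ofReal_le_ofReal
  rw [inv_le_comm₀ ht0 two_pos]
  linarith

/-- On a convex set, averages of a nonnegative function along the segments joining pairs of points,
taken at a fixed ratio `t ≥ 1 / 2`, are controlled by its integral. -/
lemma setLIntegral_setLIntegral_segment_le {K : Set E} (hK : Convex ℝ K) (hKm : MeasurableSet K)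
    {f : E → ℝ≥0∞} (hf : Measurable f) {t : ℝ} (ht : 1 / 2 ≤ t) (ht1 : t ≤ 1) :
    ∫⁻ z in K, ∫⁻ y in K, f (z + t • (y - z)) ∂μ ∂μ ≤
      2 ^ Module.finrank ℝ E * (∫⁻ y in K, f y ∂μ) * μ K := by
  rw [← setLIntegral_const]
  refine setLIntegral_mono' hKm fun z hz => ?_
  calc ∫⁻ y in K, f (z + t • (y - z)) ∂μ
      ≤ ∫⁻ y in K, K.indicator f ((z - t • z) + t • y) ∂μ := by
        refine setLIntegral_mono' hKm fun y hy => ?_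
        have h : (z - t • z) + t • y = z + t • (y - z) := by module
        rw [h, indicator_of_mem]
        exact hK.add_smul_sub_mem hz hy ⟨by linarith, ht1⟩
    _ ≤ ∫⁻ y, K.indicator f ((z - t • z) + t • y) ∂μ := setLIntegral_le_lintegral _ _
    _ ≤ 2 ^ Module.finrank ℝ E * ∫⁻ y, K.indicator f y ∂μ :=
        lintegral_comp_add_smul_le μ (hf.indicator hKm) _ ht
    _ = _ := by rw [lintegral_indicator hKm]

lemma setLIntegral_setLIntegral_lintegral_segment_le {K : Set E} (hK : Convex ℝ K)
    (hKm : MeasurableSet K) {f : E → ℝ≥0∞} (hf : Continuous f) :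
    ∫⁻ z in K, ∫⁻ y in K, (∫⁻ t in Icc (0 : ℝ) 1, f (z + t • (y - z))) ∂μ ∂μ ≤
      2 ^ Module.finrank ℝ E * (∫⁻ y in K, f y ∂μ) * μ K := by
  have hfix : ∀ t ∈ Icc (0 : ℝ) 1, ∫⁻ z in K, ∫⁻ y in K, f (z + t • (y - z)) ∂μ ∂μ ≤
      2 ^ Module.finrank ℝ E * (∫⁻ y in K, f y ∂μ) * μ K := by
    intro t ht
    rcases le_total (1 / 2) t with h | h
    · exact setLIntegral_setLIntegral_segment_le μ hK hKm hf.measurable h ht.2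
    · have hm : Measurable fun q : E × E => f (q.1 + t • (q.2 - q.1)) :=
        (hf.comp (by fun_prop)).measurable
      rw [lintegral_lintegral_swap hm.aemeasurable]
      refine (lintegral_congr fun y => lintegral_congr fun z => ?_).trans_le
        (setLIntegral_setLIntegral_segment_le μ hK hKm hf.measurable
          (t := 1 - t) (by linarith) (by linarith [ht.1]))
      congr 1
      module
  calc ∫⁻ z in K, ∫⁻ y in K, (∫⁻ t in Icc (0 : ℝ) 1, f (z + t • (y - z))) ∂μ ∂μ
      = ∫⁻ z in K, (∫⁻ t in Icc (0 : ℝ) 1, ∫⁻ y in K, f (z + t • (y - z)) ∂μ) ∂μ := by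
        refine lintegral_congr fun z => ?_
        have hm : Measurable fun q : E × ℝ => f (z + q.2 • (q.1 - z)) :=
          (hf.comp (by fun_prop)).measurable
        exact lintegral_lintegral_swap hm.aemeasurable
    _ = ∫⁻ t in Icc (0 : ℝ) 1, ∫⁻ z in K, ∫⁻ y in K, f (z + t • (y - z)) ∂μ ∂μ := by
        refine lintegral_lintegral_swap (Measurable.aemeasurable ?_)
        have hm : Measurable fun q : (E × ℝ) × E => f (q.1.1 + q.1.2 • (q.2 - q.1.1)) :=
          (hf.comp (by fun_prop)).measurable
        exact hm.lintegral_prod_right'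
    _ ≤ ∫⁻ _ in Icc (0 : ℝ) 1, 2 ^ Module.finrank ℝ E * (∫⁻ y in K, f y ∂μ) * μ K :=
        setLIntegral_mono' measurableSet_Icc hfix
    _ = _ := by simp

/-- The `L¹` Poincaré inequality on a convex set, in terms of double integrals. -/
lemma setLIntegral_setLIntegral_enorm_sub_le {K : Set E} (hK : Convex ℝ K) (hKm : MeasurableSet K)
    (hd : ediam K ≠ ∞) {u : E → ℝ} (hu : ContDiff ℝ 1 u) :
    ∫⁻ z in K, ∫⁻ y in K, ‖u y - u z‖ₑ ∂μ ∂μ ≤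
      ediam K * (2 ^ Module.finrank ℝ E * (∫⁻ y in K, ‖fderiv ℝ u y‖ₑ ∂μ) * μ K) := by
  refine le_trans ?_ (mul_le_mul_right (setLIntegral_setLIntegral_lintegral_segment_le μ hK hKm
    (hu.continuous_fderiv one_ne_zero).enorm) (ediam K))
  rw [← lintegral_const_mul' _ _ hd]
  refine setLIntegral_mono' hKm fun z hz => ?_
  rw [← lintegral_const_mul' _ _ hd]
  refine setLIntegral_mono' hKm fun y hy => (enorm_sub_le_lintegral_segment hu y z).trans ?_
  gcongr
  rw [← edist_eq_enorm_sub]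
  exact edist_le_ediam_of_mem hy hz

end Poincare

/-- Mean oscillation is controlled by the double integral of differences. -/
lemma setAverage_abs_sub_setAverage_le {α : Type*} [MeasurableSpace α]
    {μ : Measure α} {K : Set α} (hK0 : μ K ≠ 0) (hK : μ K ≠ ∞)
    {u : α → ℝ} (hu : IntegrableOn u K μ) {b : ℝ} (hb : 0 ≤ b)
    (h : ∫⁻ z in K, ∫⁻ y in K, ‖u y - u z‖ₑ ∂μ ∂μ ≤ ENNReal.ofReal b * μ K * μ K) :
    ⨍ z in K, |u z - ⨍ y in K, u y ∂μ| ∂μ ≤ b := by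
  have hpos : 0 < μ.real K := ENNReal.toReal_pos hK0 hK
  have : IsFiniteMeasure (μ.restrict K) := ⟨by simpa using hK.lt_top⟩
  have hpt : ∀ z, ‖u z - ⨍ y in K, u y ∂μ‖ₑ ≤ (μ K)⁻¹ * ∫⁻ y in K, ‖u y - u z‖ₑ ∂μ := by
    intro z
    have h1 : (⨍ y in K, u y ∂μ) - u z = (μ.real K)⁻¹ * ∫ y in K, (u y - u z) ∂μ := by
      rw [integral_sub hu (integrable_const _), setAverage_eq]
      simp
      field_simp
    rw [← enorm_neg, neg_sub, h1, enorm_mul]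
    gcongr
    · rw [Real.enorm_eq_ofReal (by positivity), ENNReal.ofReal_inv_of_pos hpos,
        ofReal_measureReal hK]
    · exact enorm_integral_le_lintegral_enorm _
  have hint : AEStronglyMeasurable (fun z => u z - ⨍ y in K, u y ∂μ) (μ.restrict K) :=
    hu.aestronglyMeasurable.sub aestronglyMeasurable_const
  rw [setAverage_eq, smul_eq_mul]
  simp_rw [← Real.norm_eq_abs]
  rw [integral_norm_eq_lintegral_enorm hint, inv_mul_le_iff₀ hpos, Measure.real,
    ← ENNReal.toReal_ofReal hb, ← ENNReal.toReal_mul]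
  refine ENNReal.toReal_mono (ENNReal.mul_ne_top hK ENNReal.ofReal_ne_top) ?_
  calc ∫⁻ z in K, ‖u z - ⨍ y in K, u y ∂μ‖ₑ ∂μ
      ≤ ∫⁻ z in K, (μ K)⁻¹ * ∫⁻ y in K, ‖u y - u z‖ₑ ∂μ ∂μ := lintegral_mono hpt
    _ = (μ K)⁻¹ * ∫⁻ z in K, ∫⁻ y in K, ‖u y - u z‖ₑ ∂μ ∂μ :=
        lintegral_const_mul' _ _ (ENNReal.inv_ne_top.2 hK0)
    _ ≤ (μ K)⁻¹ * (ENNReal.ofReal b * μ K * μ K) := by gcongr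
    _ = μ K * ENNReal.ofReal b := by
        rw [mul_comm, mul_assoc, ENNReal.mul_inv_cancel hK0 hK, mul_one, mul_comm]

lemma volume_setOf_lt_le_of_weakNorm_le {n : ℕ} {p M t : ℝ} (hp : 0 < p) (hM : 0 ≤ M) (ht : 0 < t)
    {f : EuclideanSpace ℝ (Fin n) → ℝ} {S : Set (EuclideanSpace ℝ (Fin n))}
    (h : weakNorm n p f S ≤ ENNReal.ofReal M) :
    volume {y | y ∈ S ∧ t < |f y|} ≤ ENNReal.ofReal (M ^ p * t ^ (-p)) := by
  have h1 := (le_iSup (fun lam : {t : ℝ // 0 < t} => ENNReal.ofReal lam.1 *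
    volume {y | y ∈ S ∧ lam.1 < |f y|} ^ (1 / p)) ⟨t, ht⟩).trans h
  simp only at h1
  have h2 : volume {y | y ∈ S ∧ t < |f y|} ^ (1 / p) ≤ ENNReal.ofReal (M / t) := by
    rw [ENNReal.ofReal_div_of_pos ht]
    rwa [ENNReal.le_div_iff_mul_le (.inl (by simpa using ht)) (.inl ENNReal.ofReal_ne_top),
      mul_comm]
  have h3 := ENNReal.rpow_le_rpow h2 hp.le
  rw [← ENNReal.rpow_mul, one_div_mul_cancel hp.ne', ENNReal.rpow_one,
    ENNReal.ofReal_rpow_of_nonneg (by positivity) hp.le] at h3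
  rwa [Real.rpow_neg ht.le, ← div_eq_mul_inv, ← Real.div_rpow hM ht.le]

/-- A function in weak `L^p`, `p > 1`, is integrable on sets of finite measure, with a bound obtained
by splitting the layer-cake formula at height `s`. -/
lemma setLIntegral_enorm_le_of_weakNorm_le {n : ℕ} {p M s : ℝ} (hp : 1 < p) (hM : 0 ≤ M)
    (hs : 0 < s) {f : EuclideanSpace ℝ (Fin n) → ℝ} (hf : Measurable f)
    {S : Set (EuclideanSpace ℝ (Fin n))} (hS : MeasurableSet S)
    (h : weakNorm n p f S ≤ ENNReal.ofReal M) :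
    ∫⁻ y in S, ‖f y‖ₑ ≤
      ENNReal.ofReal s * volume S + ENNReal.ofReal (M ^ p * (s ^ (1 - p) / (p - 1))) := by
  have hlc := lintegral_eq_lintegral_meas_lt (volume.restrict S) (f := fun y => |f y|)
    (.of_forall fun y => abs_nonneg _) (by fun_prop)
  simp_rw [← Real.norm_eq_abs, ofReal_norm] at hlc
  have hmeas : ∀ t, (volume.restrict S) {a | t < ‖f a‖} = volume {y | y ∈ S ∧ t < |f y|} := by
    intro t
    rw [Measure.restrict_apply' hS, inter_comm]
    rfl
  rw [hlc, ← Ioc_union_Ioi_eq_Ioi hs.le,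
    lintegral_union measurableSet_Ioi (Ioc_disjoint_Ioi le_rfl)]
  gcongr
  · calc _ ≤ ∫⁻ _ in Ioc 0 s, volume S := by
          refine lintegral_mono fun t => ?_
          rw [hmeas]
          exact measure_mono fun y hy => hy.1
      _ = _ := by simp [mul_comm]
  · calc _ ≤ ∫⁻ t in Ioi s, ENNReal.ofReal (M ^ p * t ^ (-p)) := by
          refine setLIntegral_mono' measurableSet_Ioi fun t ht => ?_
          rw [hmeas]
          exact volume_setOf_lt_le_of_weakNorm_le (by linarith) hM (hs.trans ht) h
      _ = ENNReal.ofReal (∫ t in Ioi s, M ^ p * t ^ (-p)) := by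
          refine (ofReal_integral_eq_lintegral_ofReal
            ((integrableOn_Ioi_rpow_of_lt (by linarith) hs).const_mul _) ?_).symm
          filter_upwards [self_mem_ae_restrict measurableSet_Ioi] with t ht
          have : 0 < t := hs.trans ht
          simp only [Pi.zero_apply]
          positivity
      _ ≤ _ := by
          rw [integral_const_mul, integral_Ioi_rpow_of_lt (by linarith) hs]
          apply le_of_eq
          congr 2
          rw [neg_div, ← div_neg]
          ring_nf

/-- If `‖|∇u|‖_{L^{p,∞}(B(x,R))} ≤ A R^{(n-p)/p}` for all balls, then the mean oscillation
of `u` over every ball is at most `C·A` with `C = C(n,p)`; in particular `u ∈ BMO`. -/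
theorem stmt17 (n : ℕ) (hn : 2 ≤ n) (p : ℝ) (hp : 1 < p) (hpn : p < n) :
    ∃ C : ℝ, 0 < C ∧
      ∀ u : EuclideanSpace ℝ (Fin n) → ℝ, ContDiff ℝ 1 u →
        ∀ A : ℝ, 0 < A →
          (∀ (x : EuclideanSpace ℝ (Fin n)) (R : ℝ), 0 < R →
            weakNorm n p (fun y => ‖fderiv ℝ u y‖) (ball x R) ≤
              ENNReal.ofReal (A * R ^ (((n : ℝ) - p) / p))) →
          (∀ (x : EuclideanSpace ℝ (Fin n)) (R : ℝ), 0 < R →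
            (⨍ y in ball x R, |u y - ⨍ z in ball x R, u z|) ≤ C * A) := by
  have hp0 : 0 < p := by linarith
  set ω : ℝ := volume.real (ball (0 : EuclideanSpace ℝ (Fin n)) 1) with hω
  have hωpos : 0 < ω := ENNReal.toReal_pos (measure_ball_pos _ _ one_pos).ne' measure_ball_lt_top.ne
  have hp1 : 0 < p - 1 := by linarith
  refine ⟨2 * 2 ^ n * (1 + 1 / ((p - 1) * ω)), by positivity, fun u hu A hA hw x R hR => ?_⟩
  have hK0 : volume (ball x R) ≠ 0 := (measure_ball_pos _ _ hR).ne'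
  have hK : volume (ball x R) ≠ ∞ := measure_ball_lt_top.ne
  have hvol : volume (ball x R) = ENNReal.ofReal (R ^ n * ω) := by
    rw [Measure.addHaar_ball_of_pos volume x hR, finrank_euclideanSpace_fin,
      ENNReal.ofReal_mul (by positivity), hω, ofReal_measureReal measure_ball_lt_top.ne]
  have hMs : (A * R ^ (((n : ℝ) - p) / p)) ^ p * ((A / R) ^ (1 - p) / (p - 1))
      = A / R * R ^ n / (p - 1) := by
    rw [Real.mul_rpow hA.le (by positivity), ← Real.rpow_mul hR.le, div_mul_cancel₀ _ hp0.ne',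
      Real.div_rpow hA.le hR.le, Real.rpow_sub hR, Real.rpow_sub hR, Real.rpow_sub hA,
      Real.rpow_natCast, Real.rpow_one, Real.rpow_one]
    have := Real.rpow_pos_of_pos hA p
    have := Real.rpow_pos_of_pos hR p
    field_simp
  have hgrad : ∫⁻ y in ball x R, ‖fderiv ℝ u y‖ₑ ≤
      ENNReal.ofReal (A / R * (1 + 1 / ((p - 1) * ω))) * volume (ball x R) := by
    have h := setLIntegral_enorm_le_of_weakNorm_le hp (by positivity) (div_pos hA hR)
      (hu.continuous_fderiv one_ne_zero).norm.measurable measurableSet_ball (hw x R hR)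
    simp only [enorm_norm] at h
    refine h.trans (le_of_eq ?_)
    rw [hMs, hvol, ← ENNReal.ofReal_mul (by positivity), ← ENNReal.ofReal_mul (by positivity),
      ← ENNReal.ofReal_add (by positivity) (by positivity)]
    congr 1
    field_simp
  refine setAverage_abs_sub_setAverage_le hK0 hK
    ((hu.continuous.continuousOn.integrableOn_compact (isCompact_closedBall x R)).mono_set
      ball_subset_closedBall) (by positivity) ?_
  refine (setLIntegral_setLIntegral_enorm_sub_le volume (convex_ball x R)
    measurableSet_ball isBounded_ball.ediam_ne_top hu).trans ?_
  have hdiam : ediam (ball x R) ≤ ENNReal.ofReal (2 * R) := by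
    rw [← eball_ofReal, ENNReal.ofReal_mul two_pos.le, ENNReal.ofReal_ofNat]
    exact ediam_eball_le
  have h2 : (2 : ℝ≥0∞) ^ n = ENNReal.ofReal (2 ^ n) := by
    rw [ENNReal.ofReal_pow two_pos.le, ENNReal.ofReal_ofNat]
  calc _ ≤ ENNReal.ofReal (2 * R) * (ENNReal.ofReal (2 ^ n) *
        (ENNReal.ofReal (A / R * (1 + 1 / ((p - 1) * ω))) * volume (ball x R)) *
          volume (ball x R)) := by
        rw [finrank_euclideanSpace_fin, h2]
        gcongr
    _ = ENNReal.ofReal (2 * R) * ENNReal.ofReal (2 ^ n) *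
        ENNReal.ofReal (A / R * (1 + 1 / ((p - 1) * ω))) * volume (ball x R) *
          volume (ball x R) := by ring
    _ = _ := by
        rw [← ENNReal.ofReal_mul (by positivity), ← ENNReal.ofReal_mul (by positivity)]
        congr 3
        field_simp
end
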